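/- arXiv:2106.08058 — 2 statements merged into one kernel-verified Lean document; each statement's English description precedes it below -/
import Mathlib

section
/- Let M = {1^{k_1}, 2^{k_2}, ..., n^{k_n}} be a multiset with each k_i ≥ 1 and K = k_1 + k_2 + ... + k_n. For every i with 0 ≤ i ≤ K − n, one has Σ_{T ∈ 𝒯_M, eleaf(T) = i} x^{casc(T)} y^{cdes(T)} = Σ_{T ∈ 𝒯_M, eleaf(T) = i, dcdes(T) = 0} (xy)^{cdes(T)} (x+y)^{K+1−i−2·cdes(T)} as polynomials in ℤ[x,y]. -/
/-! Common definitions: words (permutations of multisets), their statistics,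
ordered labeled trees and their cyclic statistics. -/

attribute [local instance] Classical.propDecidable

/-- `asc`: number of indices `0 ≤ i ≤ m` with `π_i < π_{i+1}`, convention `π_0 = π_{m+1} = 0`. -/
def ascW (w : List ℕ) : ℕ :=
  (((0 :: (w ++ [0])).zip (w ++ [0])).countP fun p => decide (p.1 < p.2))

def desW (w : List ℕ) : ℕ :=
  (((0 :: (w ++ [0])).zip (w ++ [0])).countP fun p => decide (p.2 < p.1))

def platW (w : List ℕ) : ℕ :=
  (((0 :: (w ++ [0])).zip (w ++ [0])).countP fun p => decide (p.1 = p.2))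

/-- quasi-Stirling: no indices `i < j < k < l` with `π_i = π_k` and `π_j = π_l`. -/
def IsQuasiStirling (w : List ℕ) : Prop :=
  ¬ ∃ l, l < w.length ∧ ∃ k, k < l ∧ ∃ j, j < k ∧ ∃ i, i < j ∧
      w.getD i 0 = w.getD k 0 ∧ w.getD j 0 = w.getD l 0

/-- Stirling: no indices `i < j < k` with `π_i = π_k` and `π_j < π_i`. -/
def IsStirling (w : List ℕ) : Prop :=
  ¬ ∃ k, k < w.length ∧ ∃ j, j < k ∧ ∃ i, i < j ∧
      w.getD i 0 = w.getD k 0 ∧ w.getD j 0 < w.getD i 0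

/-- The multiset `{1^{k 1}, 2^{k 2}, …, n^{k n}}`. -/
def msetM (n : ℕ) (k : ℕ → ℕ) : Multiset ℕ :=
  ∑ i ∈ Finset.Icc 1 n, Multiset.replicate (k i) i

/-- The finite set of all words whose multiset of letters is `M`. -/
noncomputable def permsOf (M : Multiset ℕ) : Finset (List ℕ) :=
  M.toList.permutations.toFinset

/-- The finite set of quasi-Stirling permutations of `M`. -/
noncomputable def qsPerms (M : Multiset ℕ) : Finset (List ℕ) :=
  (permsOf M).filter IsQuasiStirling

/-- The finite set of Stirling permutations of `M`. -/
noncomputable def sPerms (M : Multiset ℕ) : Finset (List ℕ) :=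
  (permsOf M).filter IsStirling

open MvPolynomial in
/-- `Q̄_M(x,y,z)`, with `x = X 0`, `y = X 1`, `z = X 2`. -/
noncomputable def QbarPoly (M : Multiset ℕ) : MvPolynomial (Fin 3) ℤ :=
  ∑ w ∈ qsPerms M, X 0 ^ ascW w * X 1 ^ desW w * X 2 ^ platW w

open MvPolynomial in
/-- `Q_M(x,y,z)`, with `x = X 0`, `y = X 1`, `z = X 2`. -/
noncomputable def QPoly (M : Multiset ℕ) : MvPolynomial (Fin 3) ℤ :=
  ∑ w ∈ sPerms M, X 0 ^ ascW w * X 1 ^ desW w * X 2 ^ platW w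

/-! Cyclic statistics of a word `w_0 w_1 … w_ℓ` read cyclically. -/

/-- Number of cyclic descents of a word: indices `i` with `w_i > w_{i+1}`, indices mod `ℓ+1`. -/
def cdesW (w : List ℕ) : ℕ := ((w.zip (w.rotate 1)).countP fun p => decide (p.2 < p.1))

/-- Number of cyclic ascents. -/
def cascW (w : List ℕ) : ℕ := ((w.zip (w.rotate 1)).countP fun p => decide (p.1 < p.2))

/-- The list of cyclic triples `(w_{i-1}, w_i, w_{i+1})`, indices mod `ℓ+1`. -/
def cycTriples (w : List ℕ) : List (ℕ × ℕ × ℕ) :=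
  (w.rotate (w.length - 1)).zip (w.zip (w.rotate 1))

/-- Number of double cyclic descents of a word: indices with `w_{i-1} > w_i > w_{i+1}`. -/
def dcdesW (w : List ℕ) : ℕ :=
  ((cycTriples w).countP fun p => decide (p.2.1 < p.1 ∧ p.2.2 < p.2.1))

/-- Number of double cyclic ascents of a word: indices with `w_{i-1} < w_i < w_{i+1}`. -/
def dcascW (w : List ℕ) : ℕ :=
  ((cycTriples w).countP fun p => decide (p.1 < p.2.1 ∧ p.2.1 < p.2.2))

/-- Number of cyclic peaks of a word: indices with `w_{i-1} < w_i > w_{i+1}`. -/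
def cpeakW (w : List ℕ) : ℕ :=
  ((cycTriples w).countP fun p => decide (p.1 < p.2.1 ∧ p.2.2 < p.2.1))

/-- Number of cyclic valleys of a word: indices with `w_{i-1} > w_i < w_{i+1}`. -/
def cvalW (w : List ℕ) : ℕ :=
  ((cycTriples w).countP fun p => decide (p.2.1 < p.1 ∧ p.2.1 < p.2.2))

/-- Ordered labeled trees: rooted plane trees with labels in `ℕ`. -/
inductive LTree : Type where
  | node (label : ℕ) (children : List LTree) : LTree

namespace LTree

/-- The label of the root. -/
def label : LTree → ℕ
  | node a _ => a

theorem sizeOf_lt_of_mem {s : LTree} {ts : List LTree} (h : s ∈ ts) {a : ℕ} :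
    sizeOf s < sizeOf (LTree.node a ts) := by
  have := List.sizeOf_lt_of_mem h
  simp only [node.sizeOf_spec]
  omega

/-- The multiset of all vertex labels. -/
def labels : LTree → Multiset ℕ
  | node a ts => a ::ₘ (ts.attach.map (fun s => labels s.1)).sum
decreasing_by exact sizeOf_lt_of_mem s.2

/-- The word `v_0 v_1 … v_ℓ` associated to a vertex: its label followed by the labels of
its children from left to right. -/
def wordOf : LTree → List ℕ
  | node a ts => a :: ts.map label

/-- `cdes(T) = ∑_{u ∈ V(T)} cdes(u)`. -/
def cdes : LTree → ℕ
  | node a ts => cdesW (a :: ts.map label) + (ts.attach.map (fun s => cdes s.1)).sum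
decreasing_by exact sizeOf_lt_of_mem s.2

/-- `casc(T) = ∑_{u ∈ V(T)} casc(u)`. -/
def casc : LTree → ℕ
  | node a ts => cascW (a :: ts.map label) + (ts.attach.map (fun s => casc s.1)).sum
decreasing_by exact sizeOf_lt_of_mem s.2

/-- Auxiliary: number of leaves at even level, `b = true` meaning the current root is at
even level. -/
def eleafAux : LTree → Bool → ℕ
  | node _ ts, b => (cond b (if ts.isEmpty then 1 else 0) 0)
      + (ts.attach.map (fun s => eleafAux s.1 !b)).sum
decreasing_by exact sizeOf_lt_of_mem s.2

/-- `eleaf(T)`: the number of leaves of `T` at even level. -/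
def eleaf (T : LTree) : ℕ := eleafAux T true

/-- Auxiliary: given a word-statistic `f`, sum `f (wordOf u)` over all vertices `u` at even
level (`b = true` meaning the current root is at even level).  Since every vertex of a tree
is classified (as a double cyclic descent/ascent, cyclic peak/valley) by exactly one index
of the word of an even vertex — an even vertex by index `0` of its own word, an odd vertex
by its position in the word of its (even) parent — the corresponding tree statistics are
obtained by summing the word statistics over the even vertices. -/
def evenSum (f : List ℕ → ℕ) : LTree → Bool → ℕ
  | node a ts, b => (cond b (f (a :: ts.map label)) 0)
      + (ts.attach.map (fun s => evenSum f s.1 !b)).sum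
decreasing_by exact sizeOf_lt_of_mem s.2

/-- `dcdes(T)`: the number of vertices of `T` that are double cyclic descents. -/
def dcdes (T : LTree) : ℕ := evenSum dcdesW T true

/-- `dcasc(T)`: the number of vertices of `T` that are double cyclic ascents. -/
def dcasc (T : LTree) : ℕ := evenSum dcascW T true

/-- `cpeak(T)`: the number of vertices of `T` that are cyclic peaks. -/
def cpeak (T : LTree) : ℕ := evenSum cpeakW T true

/-- `cval(T)`: the number of vertices of `T` that are cyclic valleys. -/
def cval (T : LTree) : ℕ := evenSum cvalW T true

/-- Auxiliary: every odd vertex labeled `i` has exactly `k i - 1` children, all labeled `i`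
(`b = true` meaning the current root is at even level). -/
def oddOK (k : ℕ → ℕ) : LTree → Bool → Prop
  | node a ts, b => (b = false → (ts.length = k a - 1 ∧ ∀ s ∈ ts, s.label = a)) ∧
      ∀ s : {x // x ∈ ts}, oddOK k s.1 (!b)
decreasing_by exact sizeOf_lt_of_mem s.2

/-- Weakly increasing: the labels along the path from the root to any leaf are weakly
increasing from top to bottom, i.e. every child's label is at least its parent's label. -/
def incr : LTree → Prop
  | node a ts => (∀ s ∈ ts, a ≤ s.label) ∧ ∀ s : {x // x ∈ ts}, incr s.1
decreasing_by exact sizeOf_lt_of_mem s.2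

end LTree

/-- Membership in `𝒯_M` for `M = {1^{k 1}, …, n^{k n}}`: the multiset of vertex labels is
`{0} ∪ M`, the root is labeled `0`, and every odd vertex labeled `i` has exactly `k i - 1`
children, all labeled `i`. -/
def memTM (n : ℕ) (k : ℕ → ℕ) (T : LTree) : Prop :=
  T.label = 0 ∧ T.labels = 0 ::ₘ msetM n k ∧ T.oddOK k true

/-- Membership in `ℐ𝒯_M`: weakly increasing trees in `𝒯_M`. -/
def memIT (n : ℕ) (k : ℕ → ℕ) (T : LTree) : Prop :=
  memTM n k T ∧ T.incr

/-! ### Arrangements of a multiset -/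

section Arrangements

variable {α R : Type*}

/-- The finite set of lists whose underlying multiset is `M`. -/
noncomputable def arrangements (M : Multiset α) : Finset (List α) := M.lists.toFinset

theorem mem_arrangements {M : Multiset α} {l : List α} :
    l ∈ arrangements M ↔ (l : Multiset α) = M := by
  rw [arrangements, Multiset.mem_toFinset, Multiset.mem_lists_iff]
  exact eq_comm

theorem mem_of_mem_arrangements {S : Finset α} {l : List α} (h : l ∈ arrangements S.val) {c : α} :
    c ∈ l ↔ c ∈ S := by
  rw [mem_arrangements] at h
  rw [← Multiset.mem_coe, h, Finset.mem_val]

theorem arrangements_zero : arrangements (0 : Multiset α) = {[]} := by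
  ext l; simp [mem_arrangements]

/-- Arrangements of `insert m S`, split at the letter `m`. -/
theorem sum_arrangements_insert [DecidableEq α] [AddCommMonoid R] {m : α} {S : Finset α} (hm : m ∉ S)
    (h : List α → R) :
    ∑ w ∈ arrangements (insert m S).val, h w =
      ∑ U ∈ S.powerset, ∑ u ∈ arrangements U.val, ∑ v ∈ arrangements (S \ U).val,
        h (u ++ m :: v) := by
  simp only [← Finset.sum_product']
  rw [Finset.sum_sigma']
  symm
  refine Finset.sum_bij (fun p _ => p.2.1 ++ m :: p.2.2) ?_ ?_ ?_ (fun _ _ => rfl)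
  · rintro ⟨U, u, v⟩ hp
    simp only [Finset.mem_sigma, Finset.mem_powerset, Finset.mem_product, mem_arrangements] at hp ⊢
    obtain ⟨hU, hu, hv⟩ := hp
    rw [Finset.insert_val_of_notMem hm, ← Multiset.coe_add, ← Multiset.cons_coe, hu, hv,
      Multiset.add_cons, Finset.sdiff_val, add_tsub_cancel_of_le (Finset.val_le_iff.2 hU)]
  · rintro ⟨U, u, v⟩ hp ⟨U', u', v'⟩ hp' heq
    simp only [Finset.mem_sigma, Finset.mem_powerset, Finset.mem_product] at hp hp'
    obtain ⟨hU, hu, hv⟩ := hp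
    obtain ⟨hU', hu', hv'⟩ := hp'
    obtain ⟨rfl, -, rfl⟩ := (List.append_cons_inj_of_notMem
      (fun hc => hm (hU ((mem_of_mem_arrangements hu).1 hc)))
      (fun hc => hm (Finset.sdiff_subset ((mem_of_mem_arrangements hv).1 hc)))).1 heq
    have : U = U' := Finset.val_injective
      ((mem_arrangements.1 hu).symm.trans (mem_arrangements.1 hu'))
    subst this
    rfl
  · intro w hw
    have hmw : m ∈ w := (mem_of_mem_arrangements hw).2 (Finset.mem_insert_self _ _)
    obtain ⟨u, v, rfl⟩ := List.append_of_mem hmw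
    rw [mem_arrangements, Finset.insert_val_of_notMem hm, ← Multiset.coe_add,
      ← Multiset.cons_coe, Multiset.add_cons, Multiset.cons_inj_right] at hw
    have hu : (u : Multiset α) ≤ S.val := hw ▸ Multiset.le_add_right _ _
    refine ⟨⟨⟨u, Multiset.nodup_of_le hu S.nodup⟩, u, v⟩, ?_, rfl⟩
    simp only [Finset.mem_sigma, Finset.mem_powerset, Finset.mem_product, mem_arrangements]
    refine ⟨Finset.val_le_iff.1 hu, trivial, ?_⟩
    rw [Finset.sdiff_val]
    simp only [← hw, add_tsub_cancel_left]

/-- For a rotation-invariant statistic, the sum over circular arrangements does not depend on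
the letter placed first. -/
theorem sum_arrangements_change_base [DecidableEq α] [AddCommMonoid R] {a b : α} {S : Finset α} (ha : a ∉ S)
    (hb : b ∉ S) (h : List α → R) (hrot : ∀ w n, h (w.rotate n) = h w) :
    ∑ w ∈ arrangements (insert b S).val, h (a :: w) =
      ∑ w ∈ arrangements (insert a S).val, h (b :: w) := by
  rw [sum_arrangements_insert hb, sum_arrangements_insert ha]
  refine Finset.sum_nbij' (S \ ·) (S \ ·) ?_ ?_ ?_ ?_ ?_
  · simp
  · simp
  · intro U hU; simpa using hU
  · intro U hU; simpa using hU
  · intro U hU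
    rw [Finset.sdiff_sdiff_eq_self (Finset.mem_powerset.1 hU), Finset.sum_comm]
    refine Finset.sum_congr rfl fun v _ => Finset.sum_congr rfl fun u _ => ?_
    have := List.rotate_append_length_eq (a :: u) (b :: v)
    rw [← List.cons_append, ← hrot (a :: u ++ b :: v), this, List.cons_append]

/-- Arrangements of `M` correspond to arrangements of its image under a map that separates the
elements of `M`. -/
theorem sum_arrangements_map [AddCommMonoid R] {β : Type*} {M : Multiset α} (e : α → β)
    (hM : (M.map e).Nodup) (h : List β → R) :
    ∑ w ∈ arrangements M, h (w.map e) = ∑ w ∈ arrangements (M.map e), h w := by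
  refine Finset.sum_bij (fun w _ => w.map e) ?_ ?_ ?_ (fun _ _ => rfl)
  · intro w hw
    rw [mem_arrangements] at hw ⊢
    rw [← hw, Multiset.map_coe]
  · intro w hw w' hw' heq
    rw [mem_arrangements] at hw hw'
    have hlen : w.length = w'.length := by simpa using congrArg List.length heq
    refine List.ext_getElem hlen fun i hi hi' => ?_
    refine Multiset.inj_on_of_nodup_map hM _ (hw ▸ List.getElem_mem hi) _
      (hw' ▸ List.getElem_mem hi') ?_
    simpa [hi, hi'] using congrArg (fun l => l[i]?) heq
  · intro w hw
    induction M using Quotient.inductionOn with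
    | h l =>
      rw [mem_arrangements, Multiset.quot_mk_to_coe, Multiset.map_coe, Multiset.coe_eq_coe,
        ← List.mem_permutations, ← List.map_permutations, List.mem_map] at hw
      obtain ⟨v, hv, rfl⟩ := hw
      exact ⟨v, mem_arrangements.2 (Multiset.coe_eq_coe.2 (List.mem_permutations.1 hv)), rfl⟩

end Arrangements

/-! ### Linear words between low boundaries -/

section LinearWords

variable {R : Type*} [CommRing R]

/-- The product over consecutive pairs of `x` for each ascent and `y` for each descent. -/
noncomputable def gapProd (x y : R) : List ℕ → R
  | a :: b :: l => (if a < b then x else if b < a then y else 1) * gapProd x y (b :: l)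
  | _ => 1

/-- The weight of the middle letter of a triple: `s` for a double ascent, `t` for a peak,
`1` for a valley and `0` for a double descent. -/
noncomputable def turnWeight (s t : R) (a b c : ℕ) : R :=
  if a < b then (if b < c then s else t) else (if b < c then 1 else 0)

/-- The product of `turnWeight` over consecutive triples. -/
noncomputable def turnProd (s t : R) : List ℕ → R
  | a :: b :: c :: l => turnWeight s t a b c * turnProd s t (b :: c :: l)
  | _ => 1

theorem gapProd_append (x y : R) (p q : List ℕ) (m : ℕ) :
    gapProd x y (p ++ m :: q) = gapProd x y (p ++ [m]) * gapProd x y (m :: q) := by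
  induction p with
  | nil => simp [gapProd]
  | cons a p ih =>
    cases p with
    | nil => simp [gapProd]
    | cons b p =>
      simp only [List.cons_append, gapProd] at ih ⊢
      rw [ih, mul_assoc]

theorem turnProd_append (s t : R) (p q : List ℕ) (l m r : ℕ) :
    turnProd s t (p ++ l :: m :: r :: q) =
      turnProd s t (p ++ [l, m]) * turnWeight s t l m r * turnProd s t (m :: r :: q) := by
  induction p with
  | nil => simp [turnProd]
  | cons a p ih =>
    rcases p with - | ⟨b, - | ⟨c, p⟩⟩
    · simp [turnProd, mul_assoc]
    · simp [turnProd, mul_assoc]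
    · simp only [List.cons_append, turnProd] at ih ⊢
      rw [ih]; ring

theorem gapProd_low_boundary (x y : R) {z z' : ℕ} {w : List ℕ} (hw : w ≠ [])
    (hz : ∀ c ∈ w, z < c) (hz' : ∀ c ∈ w, z' < c) :
    gapProd x y (z :: (w ++ [z'])) = x * y * gapProd x y w := by
  obtain ⟨l, c, rfl⟩ := (List.eq_nil_or_concat' w).resolve_left hw
  have hc : z' < c := hz' c (by simp)
  rw [List.append_assoc, List.singleton_append, ← List.cons_append, gapProd_append]
  cases l with
  | nil =>
    have := hz c (by simp)
    simp [gapProd, hc, hc.not_gt, this]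
  | cons b l =>
    have := hz b (by simp)
    simp [gapProd, hc, hc.not_gt, this]
    ring

theorem turnProd_split (s t : R) {z z' m : ℕ} {u v : List ℕ} (hz : z < m) (hz' : z' < m)
    (hu : ∀ c ∈ u, m < c) (hv : ∀ c ∈ v, m < c) :
    turnProd s t (z :: (u ++ m :: v ++ [z'])) =
      turnProd s t (z :: (u ++ [m])) * turnProd s t (m :: (v ++ [z'])) *
        (if u = [] then (if v = [] then t else s) else (if v = [] then 0 else 1)) := by
  have key : ∀ (p : List ℕ) (l r : ℕ) (q : List ℕ), z :: u = p ++ [l] → v ++ [z'] = r :: q →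
      turnProd s t (z :: (u ++ m :: v ++ [z'])) =
        turnProd s t (z :: (u ++ [m])) * turnProd s t (m :: (v ++ [z'])) *
          turnWeight s t l m r := by
    intro p l r q hp hq
    have h1 : z :: (u ++ m :: v ++ [z']) = p ++ l :: m :: r :: q := by
      rw [List.append_assoc, ← List.cons_append, hp, List.cons_append, hq]; simp
    have h2 : z :: (u ++ [m]) = p ++ [l, m] := by
      rw [← List.cons_append, hp]; simp
    rw [h1, h2, hq, turnProd_append]; ring
  rcases List.eq_nil_or_concat' u with rfl | ⟨u', l, rfl⟩ <;> rcases v with - | ⟨r, v'⟩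
  · rw [key [] z z' [] rfl rfl]; simp [turnWeight, hz, hz'.not_gt]
  · have := hv r (by simp)
    rw [key [] z r _ rfl rfl]; simp [turnWeight, hz, this]
  · have := hu l (by simp)
    rw [key (z :: u') l z' [] rfl rfl]; simp [turnWeight, this.not_gt, hz'.not_gt]
  · have h1 := hu l (by simp)
    have h2 := hv r (by simp)
    rw [key (z :: u') l r _ rfl rfl]; simp [turnWeight, h1.not_gt, h2]

theorem sum_gapProd_eq_sum_turnProd (x y : R) (S : Finset ℕ) (hS : S.Nonempty) (z z' : ℕ)
    (hz : ∀ c ∈ S, z < c) (hz' : ∀ c ∈ S, z' < c) :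
    ∑ w ∈ arrangements S.val, gapProd x y (z :: (w ++ [z'])) =
      ∑ w ∈ arrangements S.val, turnProd (x + y) (x * y) (z :: (w ++ [z'])) := by
  induction hn : S.card using Nat.strong_induction_on generalizing S z z' with
  | _ n ih =>
  subst hn
  obtain ⟨m, S', hm, hlow, rfl⟩ : ∃ m S', m ∉ S' ∧ (∀ c ∈ S', m < c) ∧ S = insert m S' :=
    ⟨S.min' hS, S.erase (S.min' hS), by simp, fun c hc => S.min'_lt_of_mem_erase_min' hS hc,
      (Finset.insert_erase (S.min'_mem hS)).symm⟩
  have hzm : z < m := hz m (by simp)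
  have hzm' : z' < m := hz' m (by simp)
  have hcard : ∀ U ⊆ S', U.card < (insert m S').card := fun U hU => by
    rw [Finset.card_insert_of_notMem hm]; exact Nat.lt_succ_of_le (Finset.card_le_card hU)
  set A : Finset ℕ → ℕ → ℕ → R := fun U z z' =>
    ∑ w ∈ arrangements U.val, gapProd x y (z :: (w ++ [z'])) with hA
  set B : Finset ℕ → ℕ → ℕ → R := fun U z z' =>
    ∑ w ∈ arrangements U.val, turnProd (x + y) (x * y) (z :: (w ++ [z'])) with hB
  have hAB : ∀ U ⊆ S', U.Nonempty → ∀ a b, (∀ c ∈ U, a < c) → (∀ c ∈ U, b < c) →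
      A U a b = B U a b := fun U hU hne a b ha hb => ih _ (hcard U hU) U hne a b ha hb rfl
  have hLHS : ∑ w ∈ arrangements (insert m S').val, gapProd x y (z :: (w ++ [z'])) =
      ∑ U ∈ S'.powerset, A U z m * A (S' \ U) m z' := by
    rw [sum_arrangements_insert hm]
    refine Finset.sum_congr rfl fun U _ => ?_
    rw [hA, Finset.sum_mul_sum]
    refine Finset.sum_congr rfl fun u _ => Finset.sum_congr rfl fun v _ => ?_
    simpa using gapProd_append x y (z :: u) (v ++ [z']) m
  have hRHS : ∑ w ∈ arrangements (insert m S').val,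
        turnProd (x + y) (x * y) (z :: (w ++ [z'])) =
      ∑ U ∈ S'.powerset, B U z m * B (S' \ U) m z' *
        (if U = ∅ then (if S' \ U = ∅ then x * y else x + y)
          else (if S' \ U = ∅ then 0 else 1)) := by
    rw [sum_arrangements_insert hm]
    refine Finset.sum_congr rfl fun U hU => ?_
    rw [Finset.mem_powerset] at hU
    rw [hB, Finset.sum_mul_sum, Finset.sum_mul]
    refine Finset.sum_congr rfl fun u hu => ?_
    rw [Finset.sum_mul]
    refine Finset.sum_congr rfl fun v hv => ?_
    have hnil : ∀ {V : Finset ℕ} {w : List ℕ}, w ∈ arrangements V.val → (w = [] ↔ V = ∅) := by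
      intro V w hw
      rw [← Finset.val_eq_zero, ← mem_arrangements.1 hw, Multiset.coe_eq_zero]
    rw [turnProd_split (x + y) (x * y) hzm hzm'
      (fun c hc => hlow c (hU ((mem_of_mem_arrangements hu).1 hc)))
      (fun c hc => hlow c (Finset.sdiff_subset ((mem_of_mem_arrangements hv).1 hc)))]
    simp only [hnil hu, hnil hv]
  rw [hLHS, hRHS]
  have hA0 : A ∅ z m = x := by simp [hA, arrangements_zero, gapProd, hzm]
  have hA0' : A ∅ m z' = y := by simp [hA, arrangements_zero, gapProd, hzm', hzm'.not_gt]
  have hB0 : ∀ a b, B ∅ a b = 1 := by intro a b; simp [hB, arrangements_zero, turnProd]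
  rcases S'.eq_empty_or_nonempty with rfl | hne
  · simp [hA0, hA0', hB0]
  have hswap : A S' z m = A S' m z' := by
    refine Finset.sum_congr rfl fun w hw => ?_
    have hw0 : w ≠ [] := by
      obtain ⟨c, hc⟩ := hne
      exact List.ne_nil_of_mem ((mem_of_mem_arrangements hw).2 hc)
    have hmem := fun c (hc : c ∈ w) => (mem_of_mem_arrangements hw).1 hc
    rw [gapProd_low_boundary x y hw0 (fun c hc => hzm.trans (hlow c (hmem c hc)))
        (fun c hc => hlow c (hmem c hc)),
      gapProd_low_boundary x y hw0 (fun c hc => hlow c (hmem c hc))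
        (fun c hc => hzm'.trans (hlow c (hmem c hc)))]
  have hmemE : ∅ ∈ S'.powerset := Finset.empty_mem_powerset _
  have hmemS : S' ∈ S'.powerset.erase ∅ :=
    Finset.mem_erase.2 ⟨hne.ne_empty, Finset.mem_powerset_self _⟩
  rw [← Finset.add_sum_erase _ _ hmemE, ← Finset.add_sum_erase _ _ hmemS,
    ← Finset.add_sum_erase (a := ∅) S'.powerset _ hmemE, ← Finset.add_sum_erase _ _ hmemS]
  have hrest : ∀ U ∈ (S'.powerset.erase ∅).erase S', A U z m * A (S' \ U) m z' =
      B U z m * B (S' \ U) m z' *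
        (if U = ∅ then (if S' \ U = ∅ then x * y else x + y)
          else (if S' \ U = ∅ then 0 else 1)) := by
    intro U hU
    simp only [Finset.mem_erase, Finset.mem_powerset] at hU
    obtain ⟨hUS, hU0, hU⟩ := hU
    have hV : S' \ U ≠ ∅ := fun h0 => hUS (hU.antisymm (Finset.sdiff_eq_empty_iff_subset.1 h0))
    rw [if_neg hU0, if_neg hV, mul_one,
      hAB U hU (Finset.nonempty_iff_ne_empty.2 hU0) _ _
        (fun c hc => hzm.trans (hlow c (hU hc))) (fun c hc => hlow c (hU hc)),
      hAB _ Finset.sdiff_subset (Finset.nonempty_iff_ne_empty.2 hV) _ _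
        (fun c hc => hlow c (Finset.sdiff_subset hc))
        (fun c hc => hzm'.trans (hlow c (Finset.sdiff_subset hc)))]
  rw [Finset.sum_congr rfl hrest]
  simp only [Finset.sdiff_empty, Finset.sdiff_self, hne.ne_empty, if_true, if_false, hA0, hA0', hB0,
    hswap]
  rw [hAB S' subset_rfl hne m z' hlow (fun c hc => hzm'.trans (hlow c hc))]
  ring

end LinearWords

/-! ### Cyclic words -/

section CyclicWords

theorem zip_rotate {α β : Type*} (l : List α) (l' : List β) (h : l.length = l'.length) (n : ℕ) :
    (l.rotate n).zip (l'.rotate n) = (l.zip l').rotate n :=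
  (List.zipWith_rotate_distrib Prod.mk l l' n h).symm

theorem cdesW_rotate (w : List ℕ) (n : ℕ) : cdesW (w.rotate n) = cdesW w := by
  rw [cdesW, List.rotate_rotate, add_comm, ← List.rotate_rotate, zip_rotate _ _ (by simp)]
  exact (List.rotate_perm _ _).countP_eq _

theorem cascW_rotate (w : List ℕ) (n : ℕ) : cascW (w.rotate n) = cascW w := by
  rw [cascW, List.rotate_rotate, add_comm, ← List.rotate_rotate, zip_rotate _ _ (by simp)]
  exact (List.rotate_perm _ _).countP_eq _

theorem dcdesW_rotate (w : List ℕ) (n : ℕ) : dcdesW (w.rotate n) = dcdesW w := by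
  rw [dcdesW, cycTriples, List.length_rotate, List.rotate_rotate, List.rotate_rotate, add_comm n,
    add_comm n, ← List.rotate_rotate, ← List.rotate_rotate, zip_rotate _ _ (by simp),
    zip_rotate _ _ (by simp)]
  exact (List.rotate_perm _ _).countP_eq _

/-- A nonempty word without repetitions can be rotated so that its least letter comes first. -/
theorem exists_rotate_min_first {w : List ℕ} (hw : w.Nodup) (hne : w ≠ []) :
    ∃ n m τ, w.rotate n = m :: τ ∧ ∀ c ∈ τ, m < c := by
  obtain ⟨m, hm, hmin⟩ := w.toFinset.exists_min_image id (by simpa using hne)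
  obtain ⟨u, v, rfl⟩ := List.append_of_mem (List.mem_toFinset.1 hm)
  refine ⟨u.length, m, v ++ u, by rw [List.rotate_append_length_eq, List.cons_append], ?_⟩
  intro c hc
  refine lt_of_le_of_ne (hmin c ?_) ?_
  · simp only [List.mem_append] at hc
    simp only [List.mem_toFinset, List.mem_append, List.mem_cons]; tauto
  · rintro rfl
    have := (List.nodup_middle.1 hw).notMem
    simp only [List.mem_append] at hc this
    tauto

theorem cascW_add_cdesW {a : ℕ} {l : List ℕ} (hl : l ≠ []) (hw : (a :: l).Nodup) :
    cascW (a :: l) + cdesW (a :: l) = l.length + 1 := by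
  obtain ⟨n, m, τ, hrot, hlow⟩ := exists_rotate_min_first hw (by simp)
  have hnd : (m :: τ).Nodup := by rw [← hrot]; simpa using hw
  have hlen : τ.length = l.length := by simpa using (congrArg List.length hrot).symm
  rw [← cascW_rotate _ n, ← cdesW_rotate _ n, hrot, ← hlen]
  have hτ : τ ≠ [] := by rintro rfl; exact hl (List.length_eq_zero_iff.1 hlen.symm)
  have key : ∀ (σ : List ℕ) (b : ℕ), (b :: σ).Nodup → (∀ c ∈ b :: σ, m < c) →
      ((b :: σ).zip (σ ++ [m])).countP (fun p => decide (p.1 < p.2)) +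
        ((b :: σ).zip (σ ++ [m])).countP (fun p => decide (p.2 < p.1)) = σ.length + 1 := by
    intro σ
    induction σ with
    | nil =>
      intro b _ hb
      have := hb b (by simp)
      simp [this, this.not_gt]
    | cons c σ ih =>
      intro b hnd hb
      have h1 := ih c (List.nodup_cons.1 hnd).2 (fun d hd => hb d (List.mem_cons_of_mem _ hd))
      have h2 : b ≠ c := by rintro rfl; simp at hnd
      simp only [List.cons_append, List.zip_cons_cons, List.countP_cons, List.length_cons,
        decide_eq_true_eq] at h1 ⊢
      rcases lt_or_gt_of_ne h2 with h | h <;> simp only [h, h.not_gt, if_true, if_false] <;> omega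
  obtain ⟨b, σ, rfl⟩ := List.exists_cons_of_ne_nil hτ
  have h1 := key σ b (List.nodup_cons.1 hnd).2 hlow
  have h2 := hlow b (by simp)
  simp only [cascW, cdesW, List.rotate_cons_succ, List.rotate_zero, List.cons_append,
    List.zip_cons_cons, List.countP_cons, decide_eq_true_eq, h2, h2.not_gt, if_true, if_false,
    List.length_cons] at h1 ⊢
  omega

variable {R : Type*} [CommRing R]

theorem pow_countP_zip_eq_gapProd (x y : R) (τ : List ℕ) (a z : ℕ) :
    x ^ ((a :: τ).zip (τ ++ [z])).countP (fun p => decide (p.1 < p.2)) *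
        y ^ ((a :: τ).zip (τ ++ [z])).countP (fun p => decide (p.2 < p.1)) =
      gapProd x y (a :: (τ ++ [z])) := by
  induction τ generalizing a with
  | nil => rcases lt_trichotomy a z with h | h | h <;> simp [gapProd, h, h.not_gt]
  | cons b τ ih =>
    simp only [List.cons_append, gapProd, ← ih b, List.zip_cons_cons, List.countP_cons,
      decide_eq_true_eq]
    rcases lt_trichotomy a b with h | h | h <;> simp [h, h.not_gt, pow_succ] <;> ring

/-- The product of turn weights, expressed by descents, ascents and double descents; `a` is an
arbitrary left boundary and `z` a low right boundary. -/
theorem turnProd_eq_ite (s t : R) (l : List ℕ) (a b z : ℕ) (hnd : (a :: b :: l).Nodup)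
    (hz : ∀ c ∈ b :: l, z < c) (cd ca dd : ℕ)
    (hcd : cd = ((b :: l).zip (l ++ [z])).countP (fun p => decide (p.2 < p.1)))
    (hca : ca = ((a :: b :: l).zip (b :: l ++ [z])).countP (fun p => decide (p.1 < p.2)))
    (hdd : dd = ((a :: b :: l).zip ((b :: l).zip (l ++ [z]))).countP
      (fun p => decide (p.2.1 < p.1 ∧ p.2.2 < p.2.1))) :
    cd ≤ ca + dd ∧ turnProd s t (a :: b :: (l ++ [z])) =
      if dd = 0 then t ^ cd * s ^ (ca - cd) else 0 := by
  induction l generalizing a b cd ca dd with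
  | nil =>
    have hb := hz b (by simp)
    have hab : a ≠ b := by rintro rfl; simp at hnd
    rcases lt_or_gt_of_ne hab with h | h <;>
      simp [hb, hb.not_gt, h, h.not_gt] at hcd hca hdd <;> subst hcd hca hdd <;>
      simp [turnProd, turnWeight, hb.not_gt, h, h.not_gt]
  | cons c l ih =>
    obtain ⟨hle, heq⟩ := ih b c (List.nodup_cons.1 hnd).2
      (fun d hd => hz d (List.mem_cons_of_mem _ hd)) _ _ _ rfl rfl rfl
    have hab : a ≠ b := by rintro rfl; simp at hnd
    have hbc : b ≠ c := by rintro rfl; simp at hnd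
    simp only [List.cons_append, List.zip_cons_cons, List.countP_cons, decide_eq_true_eq]
      at hcd hca hdd hle heq
    simp only [List.cons_append, turnProd] at heq ⊢
    rw [heq]
    generalize List.countP _ ((c :: l).zip (l ++ [z])) = X at *
    generalize List.countP _ ((c :: l).zip (l ++ [z])) = Y at *
    generalize List.countP _ ((b :: c :: l).zip ((c :: l).zip (l ++ [z]))) = D at *
    rcases lt_or_gt_of_ne hab with h | h <;> rcases lt_or_gt_of_ne hbc with h' | h' <;>
      simp only [turnWeight, h, h', h.not_gt, h'.not_gt, if_true, if_false, and_true, and_false,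
        add_zero, one_mul, zero_mul, mul_ite, mul_zero] at hcd hca hdd hle ⊢ <;>
      subst hcd hca hdd <;> refine ⟨by omega, ?_⟩
    · refine if_ctx_congr Iff.rfl (fun h0 => ?_) (fun _ => rfl)
      rw [show Y + 1 + 1 - cd = Y + 1 - cd + 1 by omega, pow_succ]; ring
    · refine if_ctx_congr Iff.rfl (fun h0 => ?_) (fun _ => rfl)
      rw [Nat.add_sub_add_right, pow_succ]; ring
    · rfl
    · rw [if_neg (Nat.succ_ne_zero D), ite_self]

theorem cycTriples_cons (m b : ℕ) (σ : List ℕ) :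
    ∃ c ∈ b :: σ, cycTriples (m :: b :: σ) =
      (c, m, b) :: (m :: b :: σ).zip ((b :: σ).zip (σ ++ [m])) := by
  obtain ⟨σ', c, h⟩ := (List.eq_nil_or_concat' (b :: σ)).resolve_left (by simp)
  refine ⟨c, by simp [h], ?_⟩
  have hlen : σ.length = σ'.length := by simpa using congrArg List.length h
  have hrot : (m :: b :: σ).rotate ((m :: b :: σ).length - 1) = c :: m :: σ' := by
    rw [h]
    simp
  have hzip : (m :: b :: σ).zip ((b :: σ).zip (σ ++ [m])) =
      (m :: σ').zip ((b :: σ).zip (σ ++ [m])) := by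
    have := List.zip_append (l₁ := m :: σ') (r₁ := [c]) (l₂ := (b :: σ).zip (σ ++ [m]))
      (r₂ := ([] : List (ℕ × ℕ))) (by simp [hlen])
    rw [h]
    rw [h] at this
    simpa using this
  rw [cycTriples, hrot, hzip]
  simp

/-- The weight of a word in the `γ`-expansion. -/
noncomputable def gammaWeight (x y : R) (w : List ℕ) : R :=
  if dcdesW w = 0 then (x * y) ^ cdesW w * (x + y) ^ (cascW w - cdesW w) else 0

theorem gammaWeight_eq_turnProd (x y : R) {m : ℕ} {τ : List ℕ} (hτ : τ ≠ [])
    (hnd : (m :: τ).Nodup) (hlow : ∀ c ∈ τ, m < c) :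
    cdesW (m :: τ) ≤ cascW (m :: τ) + dcdesW (m :: τ) ∧
      gammaWeight x y (m :: τ) = turnProd (x + y) (x * y) (m :: (τ ++ [m])) := by
  obtain ⟨b, σ, rfl⟩ := List.exists_cons_of_ne_nil hτ
  have hb := hlow b (by simp)
  obtain ⟨c, hc, htri⟩ := cycTriples_cons m b σ
  have hmc := hlow c hc
  obtain ⟨hle, heq⟩ := turnProd_eq_ite (x + y) (x * y) σ m b m hnd hlow (cdesW (m :: b :: σ))
    (cascW (m :: b :: σ)) (dcdesW (m :: b :: σ)) (by simp [cdesW, hb.not_gt]) (by simp [cascW])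
    (by simp [dcdesW, htri, hmc, hb.not_gt])
  exact ⟨hle, by rw [List.cons_append, heq, gammaWeight]⟩

theorem cdesW_singleton (a : ℕ) : cdesW [a] = 0 := by simp [cdesW]

theorem cascW_singleton (a : ℕ) : cascW [a] = 0 := by simp [cascW]

theorem dcdesW_singleton (a : ℕ) : dcdesW [a] = 0 := by simp [dcdesW, cycTriples]

theorem cdesW_le {w : List ℕ} (hw : w.Nodup) : cdesW w ≤ cascW w + dcdesW w := by
  rcases eq_or_ne w [] with rfl | hne
  · simp [cdesW]
  obtain ⟨n, m, τ, hrot, hlow⟩ := exists_rotate_min_first hw hne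
  rw [← cdesW_rotate w n, ← cascW_rotate w n, ← dcdesW_rotate w n, hrot]
  rcases eq_or_ne τ [] with rfl | hτ
  · simp [cdesW_singleton]
  · have hnd : (m :: τ).Nodup := by rw [← hrot]; simpa using hw
    exact (gammaWeight_eq_turnProd (0 : ℤ) 0 hτ hnd hlow).1

/-- The `γ`-expansion for circular arrangements of distinct letters. -/
theorem sum_arrangements_gamma (x y : R) {a : ℕ} {M : Multiset ℕ} (hM : (a ::ₘ M).Nodup) :
    ∑ w ∈ arrangements M, x ^ cascW (a :: w) * y ^ cdesW (a :: w) =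
      ∑ w ∈ arrangements M, gammaWeight x y (a :: w) := by
  obtain ⟨ha, hM'⟩ := Multiset.nodup_cons.1 hM
  lift M to Finset ℕ using hM'
  rw [Finset.mem_val] at ha
  have base : ∀ (m : ℕ) (S : Finset ℕ), (∀ c ∈ S, m < c) →
      ∑ w ∈ arrangements S.val, x ^ cascW (m :: w) * y ^ cdesW (m :: w) =
        ∑ w ∈ arrangements S.val, gammaWeight x y (m :: w) := by
    intro m S hlow
    rcases S.eq_empty_or_nonempty with rfl | hS
    · simp [arrangements_zero, gammaWeight, cdesW_singleton, cascW_singleton, dcdesW_singleton]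
    · refine Eq.trans (Finset.sum_congr rfl fun w _ => ?_)
        ((sum_gapProd_eq_sum_turnProd x y S hS m m hlow hlow).trans
          (Finset.sum_congr rfl fun w hw => ?_))
      · rw [← pow_countP_zip_eq_gapProd]
        simp [cascW, cdesW]
      · have hlow' : ∀ c ∈ w, m < c := fun c hc => hlow c ((mem_of_mem_arrangements hw).1 hc)
        have hne : w ≠ [] := by
          obtain ⟨c, hc⟩ := hS
          exact List.ne_nil_of_mem ((mem_of_mem_arrangements hw).2 hc)
        have hnd : (m :: w).Nodup := by
          refine List.nodup_cons.2 ⟨fun h => lt_irrefl _ (hlow' m h), ?_⟩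
          rw [← Multiset.coe_nodup, mem_arrangements.1 hw]
          exact S.nodup
        exact (gammaWeight_eq_turnProd x y hne hnd hlow').2.symm
  by_cases hlow : ∀ c ∈ M, a < c
  · exact base a M hlow
  push Not at hlow
  have hne : M.Nonempty := let ⟨c, hc, _⟩ := hlow; ⟨c, hc⟩
  obtain ⟨m, S, hm, hlow', rfl⟩ : ∃ m S, m ∉ S ∧ (∀ c ∈ S, m < c) ∧ M = insert m S :=
    ⟨M.min' hne, M.erase (M.min' hne), by simp, fun c hc => M.min'_lt_of_mem_erase_min' hne hc,
      (Finset.insert_erase (M.min'_mem hne)).symm⟩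
  simp only [Finset.mem_insert, not_or] at ha
  have hma : m < a := by
    obtain ⟨c, hc, hca⟩ := hlow
    rcases Finset.mem_insert.1 hc with rfl | hc
    · exact lt_of_le_of_ne hca (Ne.symm ha.1)
    · exact (hlow' c hc).trans_le hca
  rw [sum_arrangements_change_base ha.2 hm (fun w => x ^ cascW w * y ^ cdesW w)
      (fun w n => by simp only [cascW_rotate, cdesW_rotate]),
    sum_arrangements_change_base ha.2 hm (gammaWeight x y)
      (fun w n => by simp only [gammaWeight, cascW_rotate, cdesW_rotate, dcdesW_rotate])]
  refine base m _ fun c hc => ?_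
  rcases Finset.mem_insert.1 hc with rfl | hc
  · exact hma
  · exact hlow' c hc

end CyclicWords

/-! ### Recursion on trees -/

namespace LTree

@[elab_as_elim]
theorem induction_children {P : LTree → Prop}
    (h : ∀ a ts, (∀ s ∈ ts, P s) → P (node a ts)) : ∀ T, P T
  | node a ts => h a ts fun s _ => induction_children h s
termination_by T => sizeOf T
decreasing_by exact sizeOf_lt_of_mem ‹_›

theorem labels_node (a : ℕ) (ts : List LTree) :
    (node a ts).labels = a ::ₘ (ts.map labels).sum := by
  rw [labels, List.attach_map_val]

theorem cdes_node (a : ℕ) (ts : List LTree) :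
    (node a ts).cdes = cdesW (a :: ts.map label) + (ts.map cdes).sum := by
  rw [cdes, List.attach_map_val]

theorem casc_node (a : ℕ) (ts : List LTree) :
    (node a ts).casc = cascW (a :: ts.map label) + (ts.map casc).sum := by
  rw [casc, List.attach_map_val]

theorem eleafAux_node (a : ℕ) (ts : List LTree) (b : Bool) :
    (node a ts).eleafAux b =
      cond b (if ts.isEmpty then 1 else 0) 0 + (ts.map (eleafAux · !b)).sum := by
  rw [eleafAux, List.attach_map_val (f := fun s => eleafAux s !b)]

theorem evenSum_node (f : List ℕ → ℕ) (a : ℕ) (ts : List LTree) (b : Bool) :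
    (node a ts).evenSum f b =
      cond b (f (a :: ts.map label)) 0 + (ts.map (evenSum f · !b)).sum := by
  rw [evenSum, List.attach_map_val (f := fun s => evenSum f s !b)]

theorem oddOK_node (k : ℕ → ℕ) (a : ℕ) (ts : List LTree) (b : Bool) :
    (node a ts).oddOK k b ↔
      (b = false → (ts.length = k a - 1 ∧ ∀ s ∈ ts, s.label = a)) ∧ ∀ s ∈ ts, s.oddOK k !b := by
  rw [oddOK, Subtype.forall]

/-- The multiset of labels of the odd vertices (`b = true` meaning the current root is even). -/
noncomputable def oddLabels : LTree → Bool → Multiset ℕ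
  | node a ts, b => cond b 0 {a} + (ts.attach.map (fun s => oddLabels s.1 !b)).sum
decreasing_by exact sizeOf_lt_of_mem s.2

/-- The word of every even vertex consists of distinct letters. -/
def evenNodup : LTree → Bool → Prop
  | node a ts, b => (b = true → (a :: ts.map label).Nodup) ∧
      ∀ s : {x // x ∈ ts}, evenNodup s.1 (!b)
decreasing_by exact sizeOf_lt_of_mem s.2

/-- The product of `φ` over the words of the even vertices. -/
noncomputable def evenProd {R : Type*} [CommRing R] (φ : List ℕ → R) : LTree → Bool → R
  | node a ts, b => cond b (φ (a :: ts.map label)) 1 *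
      (ts.attach.map (fun s => evenProd φ s.1 !b)).prod
decreasing_by exact sizeOf_lt_of_mem s.2

/-- A canonical representative of a tree up to reordering the children of even vertices. -/
noncomputable def canon : LTree → Bool → LTree
  | node a ts, b =>
      node a (cond b (ts.attach.map (fun s => canon s.1 !b) : Multiset LTree).toList
        (ts.attach.map (fun s => canon s.1 !b)))
decreasing_by all_goals exact sizeOf_lt_of_mem s.2

theorem oddLabels_node (a : ℕ) (ts : List LTree) (b : Bool) :
    (node a ts).oddLabels b = cond b 0 {a} + (ts.map (oddLabels · !b)).sum := by
  rw [oddLabels, List.attach_map_val (f := fun s => oddLabels s !b)]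

theorem evenNodup_node (a : ℕ) (ts : List LTree) (b : Bool) :
    (node a ts).evenNodup b ↔
      (b = true → (a :: ts.map label).Nodup) ∧ ∀ s ∈ ts, s.evenNodup !b := by
  rw [evenNodup, Subtype.forall]

theorem evenProd_node {R : Type*} [CommRing R] (φ : List ℕ → R) (a : ℕ) (ts : List LTree)
    (b : Bool) :
    (node a ts).evenProd φ b =
      cond b (φ (a :: ts.map label)) 1 * (ts.map (evenProd φ · !b)).prod := by
  rw [evenProd, List.attach_map_val (f := fun s => evenProd φ s !b)]

theorem canon_node_true (a : ℕ) (ts : List LTree) :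
    (node a ts).canon true = node a (ts.map (canon · false) : Multiset LTree).toList := by
  rw [canon, List.attach_map_val (f := fun s => canon s !true)]
  rfl

theorem canon_node_false (a : ℕ) (ts : List LTree) :
    (node a ts).canon false = node a (ts.map (canon · true)) := by
  rw [canon, List.attach_map_val (f := fun s => canon s !false)]
  rfl

/-! ### Invariance under reordering -/

theorem label_canon (T : LTree) (b : Bool) : (T.canon b).label = T.label := by
  cases T; cases b
  · rw [canon_node_false]; rfl
  · rw [canon_node_true]; rfl

theorem sum_map_toList_coe {α β : Type*} [AddCommMonoid β] (l : List α) (f : α → β) :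
    ((l : Multiset α).toList.map f).sum = (l.map f).sum := by
  rw [Multiset.sum_map_toList, Multiset.map_coe, Multiset.sum_coe]

theorem labels_canon (T : LTree) (b : Bool) : (T.canon b).labels = T.labels := by
  induction T using induction_children generalizing b with
  | _ a ts ih =>
  cases b
  · rw [canon_node_false, labels_node, labels_node, List.map_map]
    exact congrArg _ (congrArg _ (List.map_congr_left fun s hs => ih s hs _))
  · rw [canon_node_true, labels_node, labels_node, sum_map_toList_coe, List.map_map]
    exact congrArg _ (congrArg _ (List.map_congr_left fun s hs => ih s hs _))

theorem eleafAux_canon (T : LTree) (b : Bool) : (T.canon b).eleafAux b = T.eleafAux b := by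
  induction T using induction_children generalizing b with
  | _ a ts ih =>
  cases b
  · rw [canon_node_false, eleafAux_node, eleafAux_node, List.map_map]
    exact congrArg _ (congrArg _ (List.map_congr_left fun s hs => ih s hs _))
  · rw [canon_node_true, eleafAux_node, eleafAux_node, sum_map_toList_coe, List.map_map]
    have hempty : (ts.map (canon · false) : Multiset LTree).toList.isEmpty = ts.isEmpty := by
      rw [Bool.eq_iff_iff]; simp [List.isEmpty_iff]
    rw [hempty]
    exact congrArg _ (congrArg _ (List.map_congr_left fun s hs => ih s hs _))

theorem oddOK_canon (k : ℕ → ℕ) (T : LTree) (b : Bool) :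
    (T.canon b).oddOK k b ↔ T.oddOK k b := by
  induction T using induction_children generalizing b with
  | _ a ts ih =>
  cases b
  · rw [canon_node_false, oddOK_node, oddOK_node]
    simp +contextual [label_canon, ih]
  · rw [canon_node_true, oddOK_node, oddOK_node]
    simp +contextual [ih]

/-! ### Finiteness -/

theorem finite_setOf_labels_card_le (B : Set ℕ) (hB : B.Finite) (N : ℕ) :
    {T : LTree | T.labels.card ≤ N ∧ ∀ c ∈ T.labels, c ∈ B}.Finite := by
  induction N with
  | zero =>
    convert Set.finite_empty
    ext ⟨a, ts⟩
    simp [labels_node]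
  | succ N ih =>
    set A := {T : LTree | T.labels.card ≤ N ∧ ∀ c ∈ T.labels, c ∈ B} with hA
    have : Finite A := ih
    refine ((hB.prod ((List.finite_length_le A N).image (List.map Subtype.val))).image
      (fun p => node p.1 p.2)).subset ?_
    rintro ⟨a, ts⟩ ⟨hcard, hmem⟩
    rw [labels_node] at hcard hmem
    rw [Multiset.card_cons, add_le_add_iff_right] at hcard
    have hle : ∀ s ∈ ts, s.labels ≤ (ts.map labels).sum := fun s hs =>
      List.single_le_sum (by simp) _ (List.mem_map_of_mem hs)
    have hts : ∀ s ∈ ts, s ∈ A := fun s hs =>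
      ⟨(Multiset.card_le_card (hle s hs)).trans hcard,
        fun c hc => hmem c (Multiset.mem_cons_of_mem (Multiset.mem_of_le (hle s hs) hc))⟩
    have hpos : ∀ s : LTree, 1 ≤ s.labels.card := by rintro ⟨a, ts⟩; simp [labels_node]
    have hlen : ts.length ≤ N := by
      refine le_trans ?_ hcard
      clear hcard hmem hle hts
      induction ts with
      | nil => simp
      | cons s ts ih' =>
        have := hpos s
        simp only [List.length_cons, List.map_cons, List.sum_cons, Multiset.card_add]
        omega
    exact ⟨(a, ts), ⟨hmem a (by simp), ts.attach.map fun s => ⟨s.1, hts s.1 s.2⟩,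
      by simpa using hlen, by simp⟩, rfl⟩

theorem finite_setOf_labels_eq (M : Multiset ℕ) : {T : LTree | T.labels = M}.Finite :=
  (finite_setOf_labels_card_le {c | c ∈ M} (by
    exact M.toFinset.finite_toSet.subset fun c hc => by simpa using hc) M.card).subset
      fun T (hT : T.labels = M) => ⟨hT ▸ le_rfl, fun c hc => hT ▸ hc⟩

theorem finite_setOf_canon_eq (C : LTree) (b : Bool) : {T : LTree | T.canon b = C}.Finite :=
  (finite_setOf_labels_eq C.labels).subset fun T (hT : T.canon b = C) => by
    rw [Set.mem_ofPred_eq, ← hT, labels_canon]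

/-! ### Summation over reordering classes -/

/-- The lists that map to `cs` under a map `c` with finite fibres, as a product of fibres. -/
theorem exists_finset_map_eq {α β R : Type*} [CommSemiring R] (c : α → β) (A : β → Finset α)
    (hA : ∀ t b, t ∈ A b ↔ c t = b) (cs : List β) :
    ∃ L : Finset (List α), (∀ ts, ts ∈ L ↔ ts.map c = cs) ∧
      ∀ w : α → R, ∑ ts ∈ L, (ts.map w).prod = (cs.map fun b => ∑ t ∈ A b, w t).prod := by
  induction cs with
  | nil => exact ⟨{[]}, by simp, by simp⟩
  | cons b cs ih =>
    obtain ⟨L, hL, hsum⟩ := ih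
    refine ⟨(A b ×ˢ L).image fun p => p.1 :: p.2, ?_, fun w => ?_⟩
    · rintro (- | ⟨t, ts⟩) <;> simp [hA, hL]
    · rw [Finset.sum_image (by rintro ⟨t, ts⟩ _ ⟨t', ts'⟩ _ h; simpa using h), Finset.sum_product]
      simp only [List.map_cons, List.prod_cons, ← hsum, Finset.sum_mul_sum]

/-- The reordering class with canonical representative `C`. -/
noncomputable def canonFiber (b : Bool) (C : LTree) : Finset LTree :=
  (finite_setOf_canon_eq C b).toFinset

theorem mem_canonFiber {b : Bool} {C T : LTree} : T ∈ canonFiber b C ↔ T.canon b = C := by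
  rw [canonFiber, Set.Finite.mem_toFinset]; rfl

variable {R : Type*} [CommRing R]

theorem sum_canonFiber_node_false (φ : List ℕ → R) (a : ℕ) (cs : List LTree) :
    ∑ T ∈ canonFiber false (node a cs), T.evenProd φ false =
      (cs.map fun C => ∑ T ∈ canonFiber true C, T.evenProd φ true).prod := by
  obtain ⟨L, hL, hsum⟩ := exists_finset_map_eq (R := R) (canon · true) (canonFiber true)
    (fun _ _ => mem_canonFiber) cs
  have himg : canonFiber false (node a cs) = L.image (node a) := by
    ext ⟨a', ts⟩
    simp only [mem_canonFiber, canon_node_false, Finset.mem_image, node.injEq, hL]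
    constructor
    · rintro ⟨rfl, h⟩; exact ⟨ts, h, rfl, rfl⟩
    · rintro ⟨ts', h, rfl, rfl⟩; exact ⟨rfl, h⟩
  rw [← hsum, himg, Finset.sum_image (by intro _ _ _ _ h; simpa using h)]
  simp [evenProd_node]

theorem sum_canonFiber_node_true (φ : List ℕ → R) (a : ℕ) (M : Multiset LTree) :
    ∑ T ∈ canonFiber true (node a M.toList), T.evenProd φ true =
      (∑ cs ∈ arrangements M, φ (a :: cs.map label)) *
        (M.map fun C => ∑ T ∈ canonFiber false C, T.evenProd φ false).prod := by
  choose L hL hsum using exists_finset_map_eq (R := R) (canon · false) (canonFiber false)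
    (fun _ _ => mem_canonFiber)
  have hfib : ∑ T ∈ canonFiber true (node a M.toList), T.evenProd φ true =
      ∑ cs ∈ arrangements M, ∑ ts ∈ L cs, (node a ts).evenProd φ true := by
    rw [Finset.sum_sigma']
    symm
    refine Finset.sum_bij (fun p _ => node a p.2) ?_ ?_ ?_ (fun _ _ => rfl)
    · rintro ⟨cs, ts⟩ hp
      rw [Finset.mem_sigma, mem_arrangements, hL] at hp
      rw [mem_canonFiber, canon_node_true, hp.2, hp.1]
    · rintro ⟨cs, ts⟩ hp ⟨cs', ts'⟩ hp' heq
      simp only [Finset.mem_sigma, hL, node.injEq, true_and] at hp hp' heq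
      obtain rfl : ts = ts' := heq
      obtain rfl : cs = cs' := hp.2.symm.trans hp'.2
      rfl
    · rintro ⟨a', ts⟩ hT
      rw [mem_canonFiber, canon_node_true, node.injEq] at hT
      obtain ⟨rfl, h⟩ := hT
      refine ⟨⟨ts.map (canon · false), ts⟩, ?_, rfl⟩
      rw [Finset.mem_sigma, mem_arrangements, hL]
      exact ⟨by rw [← Multiset.coe_toList M, ← h, Multiset.coe_toList], rfl⟩
  rw [hfib, Finset.sum_mul]
  refine Finset.sum_congr rfl fun cs hcs => ?_
  rw [← mem_arrangements.1 hcs, Multiset.map_coe, Multiset.prod_coe, ← hsum, Finset.mul_sum]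
  refine Finset.sum_congr rfl fun ts hts => ?_
  have hlab : ts.map label = cs.map label := by
    rw [← (hL cs ts).1 hts, List.map_map]
    exact List.map_congr_left fun s _ => (label_canon s false).symm
  rw [evenProd_node, hlab]
  rfl

/-- If two word weights have equal sums over circular arrangements of distinct letters, then the
corresponding tree weights have equal sums over reordering classes. -/
theorem sum_canonFiber_congr {φ ψ : List ℕ → R}
    (h : ∀ (a : ℕ) (M : Multiset ℕ), (a ::ₘ M).Nodup →
      ∑ w ∈ arrangements M, φ (a :: w) = ∑ w ∈ arrangements M, ψ (a :: w))
    (T₀ : LTree) (b : Bool) (hT₀ : T₀.evenNodup b) :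
    ∑ T ∈ canonFiber b (T₀.canon b), T.evenProd φ b =
      ∑ T ∈ canonFiber b (T₀.canon b), T.evenProd ψ b := by
  induction T₀ using induction_children generalizing b with
  | _ a ts ih =>
  rw [evenNodup_node] at hT₀
  cases b
  · rw [canon_node_false, sum_canonFiber_node_false, sum_canonFiber_node_false, List.map_map,
      List.map_map]
    exact congrArg _ (List.map_congr_left fun s hs => ih s hs true (hT₀.2 s hs))
  · have hmap : (ts.map (canon · false) : Multiset LTree).map label = ts.map label := by
      rw [Multiset.map_coe, List.map_map]
      exact congrArg _ (List.map_congr_left fun s _ => label_canon s false)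
    have hnd : (a ::ₘ (ts.map label : Multiset ℕ)).Nodup := by
      rw [Multiset.cons_coe, Multiset.coe_nodup]; exact hT₀.1 rfl
    rw [canon_node_true, sum_canonFiber_node_true, sum_canonFiber_node_true]
    congr 1
    · have hnd' := hmap ▸ (Multiset.nodup_cons.1 hnd).2
      rw [sum_arrangements_map label hnd' (fun w => φ (a :: w)),
        sum_arrangements_map label hnd' (fun w => ψ (a :: w)), hmap]
      exact h a _ hnd
    · rw [Multiset.map_coe, Multiset.map_coe, List.map_map, List.map_map]
      exact congrArg (fun l : List R => (l : Multiset R).prod)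
        (List.map_congr_left fun s hs => ih s hs false (hT₀.2 s hs))

/-! ### Statistics of trees -/

theorem evenProd_pow (x y : R) (f g : List ℕ → ℕ) (T : LTree) (b : Bool) :
    T.evenProd (fun w => x ^ f w * y ^ g w) b = x ^ T.evenSum f b * y ^ T.evenSum g b := by
  induction T using induction_children generalizing b with
  | _ a ts ih =>
  have hprod : (ts.map (evenProd (fun w => x ^ f w * y ^ g w) · !b)).prod =
      x ^ (ts.map (evenSum f · !b)).sum * y ^ (ts.map (evenSum g · !b)).sum := by
    induction ts with
    | nil => simp
    | cons s ts ih' =>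
      simp only [List.map_cons, List.prod_cons, List.sum_cons, pow_add]
      rw [ih s (by simp), ih' fun s hs => ih s (by simp [hs])]
      ring
  rw [evenProd_node, evenSum_node, evenSum_node, hprod]
  cases b
  · simp
  · simp only [cond_true, pow_add]; ring

theorem evenProd_gammaWeight (x y : R) (T : LTree) (b : Bool) (hT : T.evenNodup b) :
    T.evenSum cdesW b ≤ T.evenSum cascW b + T.evenSum dcdesW b ∧
    T.evenProd (gammaWeight x y) b =
      if T.evenSum dcdesW b = 0 then
        (x * y) ^ T.evenSum cdesW b * (x + y) ^ (T.evenSum cascW b - T.evenSum cdesW b)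
      else 0 := by
  have hcomb : ∀ {d₁ d₂ a₁ a₂ e₁ e₂ : ℕ}, d₁ ≤ a₁ + e₁ → d₂ ≤ a₂ + e₂ →
      (if e₁ = 0 then (x * y) ^ d₁ * (x + y) ^ (a₁ - d₁) else 0) *
        (if e₂ = 0 then (x * y) ^ d₂ * (x + y) ^ (a₂ - d₂) else 0) =
      if e₁ + e₂ = 0 then (x * y) ^ (d₁ + d₂) * (x + y) ^ (a₁ + a₂ - (d₁ + d₂)) else 0 := by
    intro d₁ d₂ a₁ a₂ e₁ e₂ h₁ h₂
    by_cases he₁ : e₁ = 0 <;> by_cases he₂ : e₂ = 0 <;> simp only [he₁, he₂, Nat.add_eq_zero_iff,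
      and_true, and_false, if_true, if_false, zero_mul, mul_zero]
    rw [show a₁ + a₂ - (d₁ + d₂) = a₁ - d₁ + (a₂ - d₂) by omega, pow_add, pow_add]
    ring
  induction T using induction_children generalizing b with
  | _ a ts ih =>
  rw [evenNodup_node] at hT
  obtain ⟨hroot, hts⟩ := hT
  have hchildren : (ts.map (evenSum cdesW · !b)).sum ≤
        (ts.map (evenSum cascW · !b)).sum + (ts.map (evenSum dcdesW · !b)).sum ∧
      (ts.map (evenProd (gammaWeight x y) · !b)).prod =
        if (ts.map (evenSum dcdesW · !b)).sum = 0 then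
          (x * y) ^ (ts.map (evenSum cdesW · !b)).sum *
            (x + y) ^ ((ts.map (evenSum cascW · !b)).sum - (ts.map (evenSum cdesW · !b)).sum)
        else 0 := by
    clear hroot
    induction ts with
    | nil => simp
    | cons s ts ih' =>
      obtain ⟨h₁, h₂⟩ := ih s (by simp) _ (hts s (by simp))
      obtain ⟨h₃, h₄⟩ := ih' (fun s hs => ih s (by simp [hs])) fun s hs => hts s (by simp [hs])
      simp only [List.map_cons, List.prod_cons, List.sum_cons]
      exact ⟨by omega, by rw [h₂, h₄, hcomb h₁ h₃]⟩
  obtain ⟨hle, hprod⟩ := hchildren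
  simp only [evenProd_node, evenSum_node]
  rw [hprod]
  cases b
  · simp only [cond_false, zero_add, one_mul]
    exact ⟨hle, trivial⟩
  · have hle' := cdesW_le (hroot rfl)
    simp only [cond_true]
    exact ⟨by omega, hcomb hle' hle⟩

theorem cdesW_eq_zero {a : ℕ} {l : List ℕ} (h : ∀ c ∈ l, c = a) : cdesW (a :: l) = 0 := by
  rw [cdesW, List.countP_eq_zero]
  rintro ⟨p, q⟩ hpq
  obtain ⟨hp, hq⟩ := List.of_mem_zip hpq
  rw [List.mem_rotate] at hq
  have h' : ∀ c ∈ a :: l, c = a := by simpa using h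
  simp [h' p hp, h' q hq]

theorem cascW_eq_zero {a : ℕ} {l : List ℕ} (h : ∀ c ∈ l, c = a) : cascW (a :: l) = 0 := by
  rw [cascW, List.countP_eq_zero]
  rintro ⟨p, q⟩ hpq
  obtain ⟨hp, hq⟩ := List.of_mem_zip hpq
  rw [List.mem_rotate] at hq
  have h' : ∀ c ∈ a :: l, c = a := by simpa using h
  simp [h' p hp, h' q hq]

theorem cdes_eq_evenSum {k : ℕ → ℕ} (T : LTree) (b : Bool) (hT : T.oddOK k b) :
    T.cdes = T.evenSum cdesW b := by
  induction T using induction_children generalizing b with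
  | _ a ts ih =>
  rw [oddOK_node] at hT
  rw [cdes_node, evenSum_node, List.map_congr_left fun s hs => ih s hs (!b) (hT.2 s hs)]
  cases b
  · rw [cdesW_eq_zero (by simpa using (hT.1 rfl).2)]; rfl
  · rfl

theorem casc_eq_evenSum {k : ℕ → ℕ} (T : LTree) (b : Bool) (hT : T.oddOK k b) :
    T.casc = T.evenSum cascW b := by
  induction T using induction_children generalizing b with
  | _ a ts ih =>
  rw [oddOK_node] at hT
  rw [casc_node, evenSum_node, List.map_congr_left fun s hs => ih s hs (!b) (hT.2 s hs)]
  cases b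
  · rw [cascW_eq_zero (by simpa using (hT.1 rfl).2)]; rfl
  · rfl

theorem evenSum_casc_add_cdes_add_eleaf (T : LTree) (b : Bool) (hT : T.evenNodup b) :
    T.evenSum cascW b + T.evenSum cdesW b + T.eleafAux b + cond b 0 1 = T.labels.card := by
  induction T using induction_children generalizing b with
  | _ a ts ih =>
  rw [evenNodup_node] at hT
  obtain ⟨hroot, hts⟩ := hT
  have hchildren : (ts.map (evenSum cascW · !b)).sum + (ts.map (evenSum cdesW · !b)).sum +
      (ts.map (eleafAux · !b)).sum + cond b ts.length 0 = (ts.map labels).sum.card := by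
    clear hroot
    induction ts with
    | nil => simp
    | cons s ts ih' =>
      have h₁ := ih s (by simp) _ (hts s (by simp))
      have h₂ := ih' (fun s hs => ih s (by simp [hs])) fun s hs => hts s (by simp [hs])
      cases b <;> simp at h₁ h₂ ⊢ <;> omega
  rw [evenSum_node, evenSum_node, eleafAux_node, labels_node, Multiset.card_cons]
  cases b
  · simp at hchildren ⊢; omega
  · rcases eq_or_ne ts [] with rfl | hne
    · simp [cascW_singleton, cdesW_singleton]
    · have := cascW_add_cdesW (by simpa using hne) (hroot rfl)
      simp [hne] at hchildren this ⊢; omega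

theorem labels_count (k : ℕ → ℕ) (T : LTree) (b : Bool) (hT : T.oddOK k b) (j : ℕ) :
    T.labels.count j =
      cond b (if j = T.label then 1 else 0) 0 + (T.oddLabels b).count j * (k j - 1 + 1) := by
  induction T using induction_children generalizing b with
  | _ a ts ih =>
  rw [oddOK_node] at hT
  obtain ⟨hodd, hts⟩ := hT
  have hchildren : (ts.map labels).sum.count j =
      cond b 0 ((ts.map label).count j) +
        (ts.map (oddLabels · !b)).sum.count j * (k j - 1 + 1) := by
    clear hodd
    induction ts with
    | nil => simp
    | cons s ts ih' =>
      have h₁ := ih s (by simp) _ (hts s (by simp))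
      have h₂ := ih' (fun s hs => ih s (by simp [hs])) fun s hs => hts s (by simp [hs])
      simp only [List.map_cons, List.sum_cons, Multiset.count_add, h₁, h₂, List.count_cons]
      cases b
      · by_cases hj : j = s.label
        · simp [hj]; ring
        · simp [hj, Ne.symm hj]; ring
      · simp; ring
  rw [labels_node, oddLabels_node, Multiset.count_cons, hchildren]
  cases b
  · obtain ⟨hlen, hlab⟩ := hodd rfl
    have hrep : ts.map label = List.replicate (k a - 1) a := by
      rw [List.eq_replicate_iff]; simpa [hlen] using hlab
    rw [hrep]
    by_cases hj : j = a
    · subst hj; simp; ring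
    · simp [hj, Ne.symm hj, List.count_replicate]
  · by_cases hj : j = a <;> simp [label, hj, add_comm]

theorem evenNodup_of_oddLabels_nodup {k : ℕ → ℕ} (T : LTree) (b : Bool) (hT : T.oddOK k b)
    (hnd : (T.oddLabels b).Nodup) (hroot : b = true → T.label ∉ T.oddLabels b) :
    T.evenNodup b := by
  induction T using induction_children generalizing b with
  | _ a ts ih =>
  rw [oddOK_node] at hT
  rw [oddLabels_node] at hnd hroot
  rw [evenNodup_node]
  have hle : ∀ s ∈ ts, s.oddLabels (!b) ≤ (ts.map (oddLabels · !b)).sum := fun s hs =>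
    List.single_le_sum (by simp) _ (List.mem_map.2 ⟨s, hs, rfl⟩)
  have hnd' : (ts.map (oddLabels · !b)).sum.Nodup :=
    Multiset.nodup_of_le (Multiset.le_add_left _ _) hnd
  refine ⟨?_, fun s hs => ih s hs _ (hT.2 s hs) (Multiset.nodup_of_le (hle s hs) hnd') ?_⟩
  · rintro rfl
    have hsub : (ts.map label : Multiset ℕ) ≤ (ts.map (oddLabels · false)).sum := by
      clear ih hT hnd hroot hle hnd'
      induction ts with
      | nil => simp
      | cons s ts ih' =>
        obtain ⟨c, us⟩ := s
        rw [List.map_cons, List.map_cons, List.sum_cons, oddLabels_node, ← Multiset.cons_coe,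
          ← Multiset.singleton_add]
        exact add_le_add (Multiset.le_add_right _ _) ih'
    rw [← Multiset.coe_nodup, ← Multiset.cons_coe, Multiset.nodup_cons]
    refine ⟨fun hmem => hroot rfl ?_, Multiset.nodup_of_le hsub hnd'⟩
    simpa [label] using Multiset.mem_of_le hsub hmem
  · intro hb
    obtain rfl : b = false := by simpa using hb
    rw [(hT.1 rfl).2 s hs]
    intro hmem
    rw [cond_false, Multiset.singleton_add, Multiset.nodup_cons] at hnd
    exact hnd.1 (Multiset.mem_of_le (hle s hs) hmem)

end LTree

theorem count_msetM (n : ℕ) (k : ℕ → ℕ) (j : ℕ) :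
    (msetM n k).count j = if j ∈ Finset.Icc 1 n then k j else 0 := by
  rw [msetM, Multiset.count_sum']
  simp [Multiset.count_replicate]

theorem card_msetM (n : ℕ) (k : ℕ → ℕ) : (msetM n k).card = ∑ i ∈ Finset.Icc 1 n, k i := by
  simp [msetM]

theorem memTM.evenNodup {n : ℕ} {k : ℕ → ℕ} {T : LTree} (hT : memTM n k T) :
    T.evenNodup true := by
  obtain ⟨hlabel, hlabels, hodd⟩ := hT
  have hcount : ∀ j, (T.oddLabels true).count j * (k j - 1 + 1) =
      if j ∈ Finset.Icc 1 n then k j else 0 := by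
    intro j
    have h := LTree.labels_count k T true hodd j
    rw [hlabels, Multiset.count_cons, count_msetM, hlabel, cond_true] at h
    omega
  refine LTree.evenNodup_of_oddLabels_nodup T true hodd ?_ fun _ => ?_
  · rw [Multiset.nodup_iff_count_le_one]
    intro j
    have h : (T.oddLabels true).count j * (k j - 1 + 1) ≤ k j := by
      rw [hcount]; split_ifs <;> omega
    by_contra! hlt
    have h2 : 2 * (k j - 1 + 1) ≤ (T.oddLabels true).count j * (k j - 1 + 1) :=
      Nat.mul_le_mul_right _ hlt
    omega
  · rw [hlabel, ← Multiset.count_eq_zero]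
    simpa using hcount 0

theorem memTM_canon {n : ℕ} {k : ℕ → ℕ} {T : LTree} : memTM n k (T.canon true) ↔ memTM n k T := by
  rw [memTM, memTM, LTree.label_canon, LTree.labels_canon, LTree.oddOK_canon]

theorem memTM.exponent {n : ℕ} {k : ℕ → ℕ} {T : LTree} (hT : memTM n k T) :
    T.evenSum cascW true + T.evenSum cdesW true + T.eleaf = ∑ i ∈ Finset.Icc 1 n, k i + 1 := by
  have h := LTree.evenSum_casc_add_cdes_add_eleaf T true hT.evenNodup
  rw [hT.2.1, Multiset.card_cons, card_msetM] at h
  exact h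

theorem finsum_memTM_eq {R : Type*} [CommRing R] (x y : R) (n : ℕ) (k : ℕ → ℕ) (i : ℕ) :
    (∑ᶠ T ∈ {T : LTree | memTM n k T ∧ T.eleaf = i}, x ^ T.casc * y ^ T.cdes) =
      ∑ᶠ T ∈ {T : LTree | memTM n k T ∧ T.eleaf = i ∧ T.dcdes = 0},
        (x * y) ^ T.cdes * (x + y) ^ (∑ j ∈ Finset.Icc 1 n, k j + 1 - i - 2 * T.cdes) := by
  have hfin : {T : LTree | memTM n k T ∧ T.eleaf = i}.Finite :=
    (LTree.finite_setOf_labels_eq (0 ::ₘ msetM n k)).subset fun T hT => hT.1.2.1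
  set S : Finset LTree := hfin.toFinset with hS
  have memS : ∀ {T}, T ∈ S ↔ memTM n k T ∧ T.eleaf = i := by
    intro T; rw [hS, Set.Finite.mem_toFinset]; rfl
  have hleft : (∑ᶠ T ∈ {T : LTree | memTM n k T ∧ T.eleaf = i}, x ^ T.casc * y ^ T.cdes) =
      ∑ T ∈ S, T.evenProd (fun w => x ^ cascW w * y ^ cdesW w) true := by
    rw [finsum_mem_eq_finite_toFinset_sum _ hfin]
    refine Finset.sum_congr rfl fun T hT => ?_
    have hodd := (memS.1 hT).1.2.2
    rw [LTree.evenProd_pow, LTree.casc_eq_evenSum T true hodd, LTree.cdes_eq_evenSum T true hodd]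
  have hright : (∑ᶠ T ∈ {T : LTree | memTM n k T ∧ T.eleaf = i ∧ T.dcdes = 0},
        (x * y) ^ T.cdes * (x + y) ^ (∑ j ∈ Finset.Icc 1 n, k j + 1 - i - 2 * T.cdes)) =
      ∑ T ∈ S, T.evenProd (gammaWeight x y) true := by
    have hset : {T : LTree | memTM n k T ∧ T.eleaf = i ∧ T.dcdes = 0} =
        ((S.filter fun T => T.dcdes = 0 : Finset LTree) : Set LTree) := by
      ext T
      simp [memS, and_assoc]
    rw [hset, finsum_mem_coe_finset, Finset.sum_filter]
    refine Finset.sum_congr rfl fun T hT => ?_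
    obtain ⟨hmem, hleaf⟩ := memS.1 hT
    obtain ⟨-, heq⟩ := LTree.evenProd_gammaWeight x y T true hmem.evenNodup
    have hexp := hmem.exponent
    rw [heq, LTree.cdes_eq_evenSum T true hmem.2.2, LTree.dcdes,
      show ∑ j ∈ Finset.Icc 1 n, k j + 1 - i - 2 * T.evenSum cdesW true =
        T.evenSum cascW true - T.evenSum cdesW true by omega]
  rw [hleft, hright,
    ← Finset.sum_fiberwise_of_maps_to (t := S.image (LTree.canon · true))
      (fun T hT => Finset.mem_image_of_mem _ hT),
    ← Finset.sum_fiberwise_of_maps_to (t := S.image (LTree.canon · true))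
      (fun T hT => Finset.mem_image_of_mem _ hT)]
  refine Finset.sum_congr rfl fun C hC => ?_
  obtain ⟨T₀, hT₀, rfl⟩ := Finset.mem_image.1 hC
  have hfiber : S.filter (fun T => T.canon true = T₀.canon true) =
      LTree.canonFiber true (T₀.canon true) := by
    ext T
    rw [Finset.mem_filter, LTree.mem_canonFiber, and_iff_right_iff_imp]
    intro hT
    rw [memS, ← memTM_canon, LTree.eleaf, ← LTree.eleafAux_canon, hT, memTM_canon,
      LTree.eleafAux_canon]
    exact memS.1 hT₀
  rw [hfiber]
  exact LTree.sum_canonFiber_congr (fun a M hM => sum_arrangements_gamma x y hM) T₀ true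
    (memS.1 hT₀).1.evenNodup

open MvPolynomial in
/-- For `M = {1^{k 1}, …, n^{k n}}` with every `k i ≥ 1` and `K = k 1 + ⋯ + k n`, and any
`0 ≤ i ≤ K - n`,
`∑_{T ∈ 𝒯_M, eleaf T = i} x^{casc T} y^{cdes T}
   = ∑_{T ∈ 𝒯_M, eleaf T = i, dcdes T = 0} (xy)^{cdes T} (x+y)^{K+1-i-2 cdes T}`
in `ℤ[x,y]`.  Here `x = X 0`, `y = X 1` in `MvPolynomial (Fin 2) ℤ`. -/
theorem tree_poly_orbit_identity
    (n : ℕ) (k : ℕ → ℕ) (hk : ∀ i, 1 ≤ i → i ≤ n → 1 ≤ k i)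
    (K : ℕ) (hK : K = ∑ i ∈ Finset.Icc 1 n, k i)
    (i : ℕ) (hi : i ≤ K - n) :
    (∑ᶠ T ∈ {T : LTree | memTM n k T ∧ T.eleaf = i},
        (X 0 : MvPolynomial (Fin 2) ℤ) ^ T.casc * X 1 ^ T.cdes)
      = ∑ᶠ T ∈ {T : LTree | memTM n k T ∧ T.eleaf = i ∧ T.dcdes = 0},
          ((X 0 : MvPolynomial (Fin 2) ℤ) * X 1) ^ T.cdes
            * (X 0 + X 1) ^ (K + 1 - i - 2 * T.cdes) := by
  subst hK
  exact finsum_memTM_eq _ _ n k i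
end

section
/- Let M = {1^{k_1}, 2^{k_2}, ..., n^{k_n}} be a multiset with each k_i ≥ 1 and K = k_1 + k_2 + ... + k_n. Then the polynomial Q̄_M(x,y,z) = Σ_{π quasi-Stirling permutation of M} x^{asc(π)} y^{des(π)} z^{plat(π)} is partial γ-positive: there exist nonnegative integers γ_{i,j} (0 ≤ i ≤ K − n, 1 ≤ j ≤ ⌊(K+1−i)/2⌋) such that Q̄_M(x,y,z) = Σ_{i=0}^{K−n} z^i Σ_{j=1}^{⌊(K+1−i)/2⌋} γ_{i,j} (xy)^j (x+y)^{K+1−i−2j} in ℤ[x,y,z]. -/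
/-! Common definitions: words (permutations of multisets), their statistics,
ordered labeled trees and their cyclic statistics. -/

attribute [local instance] Classical.propDecidable

namespace QuasiStirling

/-- `p, q, r` are in (strict) cyclic order. -/
def Cyc (p q r : ℕ) : Prop := p < q ∧ q < r ∨ q < r ∧ r < p ∨ r < p ∧ p < q

open Classical in
/-- The relations satisfied by the path sums `P p q` between letters outside `A`:
a closed walk contributes `z + Z`, and up to the factor `x + Z` or `y + Z` path sums compose. -/
structure IsTransfer {R : Type*} [CommSemiring R] (x y z Z : R) (A : List ℕ)
    (P : ℕ → ℕ → R) : Prop where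
  diag : ∀ p ∉ A, P p p = z + Z
  two : ∀ p ∉ A, ∀ q ∉ A, p ≠ q → P p q * P q p = (x + Z) * (y + Z)
  three : ∀ p ∉ A, ∀ q ∉ A, ∀ r ∉ A, p ≠ q → q ≠ r → p ≠ r →
    P p q * P q r = P p r * (if Cyc p q r then x + Z else y + Z)

/-- The weight of a step from the letter `p` to the letter `q`. -/
def step {R : Type*} (x y z : R) (p q : ℕ) : R := if p < q then x else if q < p then y else z

theorem isTransfer_nil {R : Type*} [CommSemiring R] (x y z : R) :
    IsTransfer x y z 0 [] (step x y z) where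
  diag p _ := by simp [step]
  two p _ q _ h := by
    unfold step
    split_ifs <;> first | omega | simp [mul_comm]
  three p _ q _ r _ h₁ h₂ h₃ := by
    unfold step Cyc
    split_ifs <;> first | omega | simp [mul_comm]

theorem Cyc.insert_iff {p q r : ℕ} (h : Cyc p q r) {a : ℕ} (hq : q ≠ a) (hr : r ≠ a) :
    (Cyc p a r ↔ Cyc p a q ∨ Cyc q a r) ∧ ¬ (Cyc p a q ∧ Cyc q a r) := by
  unfold Cyc at *
  rcases h with h | h | h <;> constructor <;> omega

theorem Cyc.of_not {p q r : ℕ} (h : ¬ Cyc p q r) (hpq : p ≠ q) (hqr : q ≠ r) (hpr : p ≠ r) :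
    Cyc r q p := by
  unfold Cyc at *
  omega

theorem Cyc.not_swap {p q r : ℕ} (h : Cyc p q r) : ¬ Cyc r q p := by
  unfold Cyc at *
  omega

theorem Cyc.swap_iff {p q r : ℕ} (hpq : p ≠ q) (hqr : q ≠ r) (hpr : p ≠ r) :
    Cyc r q p ↔ ¬ Cyc p q r :=
  ⟨fun h h' => h.not_swap h', fun h => Cyc.of_not h hpq hqr hpr⟩

open Classical in
/-- Inserting a fourth letter `a` into a cyclically ordered triple. -/
theorem cyc_insert {R : Type*} [CommSemiring R] (X Y v : R) {p q r a : ℕ} (hpq : p ≠ q)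
    (hqr : q ≠ r) (hpr : p ≠ r) (hp : p ≠ a) (hq : q ≠ a) (hr : r ≠ a) :
    (if Cyc p q r then X else Y) *
        ((1 + v * if Cyc p a q then X else Y) * (1 + v * if Cyc q a r then X else Y))
      = (1 + v * if Cyc p a r then X else Y) *
        (if Cyc p q r then X * (1 + v * Y) else Y * (1 + v * X)) := by
  by_cases h : Cyc p q r
  · obtain ⟨h₁, h₂⟩ := h.insert_iff hq hr
    by_cases h₃ : Cyc p a q <;> by_cases h₄ : Cyc q a r <;> simp_all <;> ring
  · have h' := Cyc.of_not h hpq hqr hpr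
    obtain ⟨h₁, h₂⟩ := h'.insert_iff hq hp
    rw [Cyc.swap_iff hp hr.symm hpr, Cyc.swap_iff hq hr.symm hqr,
      Cyc.swap_iff hp hq.symm hpq] at *
    by_cases h₃ : Cyc p a q <;> by_cases h₄ : Cyc q a r <;> simp_all <;> ring

theorem IsTransfer.cons {R : Type*} [CommSemiring R] {x y z Z : R} {A : List ℕ}
    {P : ℕ → ℕ → R} (h : IsTransfer x y z Z A P) {a : ℕ} (ha : a ∉ A) (v : R) :
    IsTransfer x y z (Z + v * ((x + Z) * (y + Z))) (a :: A)
      (fun p q => P p q + v * (P p a * P a q)) where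
  diag p hp := by
    rw [List.mem_cons, not_or] at hp
    rw [h.diag p hp.2, h.two p hp.2 a ha hp.1, add_assoc]
  two p hp q hq hpq := by
    rw [List.mem_cons, not_or] at hp hq
    rw [h.three p hp.2 a ha q hq.2 hp.1 (Ne.symm hq.1) hpq,
      h.three q hq.2 a ha p hp.2 hq.1 (Ne.symm hp.1) (Ne.symm hpq)]
    have key := h.two p hp.2 q hq.2 hpq
    rw [show ∀ s t : R, (P p q + v * (P p q * s)) * (P q p + v * (P q p * t)) =
      (P p q * P q p) * ((1 + v * s) * (1 + v * t)) from fun s t => by ring, key]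
    have h₂ := Cyc.swap_iff hp.1 (Ne.symm hq.1) hpq
    by_cases h₁ : Cyc p a q
    · simp only [h₁, h₂.not.2 (not_not.2 h₁), if_true, if_false]
      ring
    · simp only [h₁, h₂.2 h₁, if_true, if_false]
      ring
  three p hp q hq r hr hpq hqr hpr := by
    rw [List.mem_cons, not_or] at hp hq hr
    rw [h.three p hp.2 a ha q hq.2 hp.1 (Ne.symm hq.1) hpq,
      h.three q hq.2 a ha r hr.2 hq.1 (Ne.symm hr.1) hqr,
      h.three p hp.2 a ha r hr.2 hp.1 (Ne.symm hr.1) hpr]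
    have key := h.three p hp.2 q hq.2 r hr.2 hpq hqr hpr
    rw [show ∀ s t : R, (P p q + v * (P p q * s)) * (P q r + v * (P q r * t)) =
      (P p q * P q r) * ((1 + v * s) * (1 + v * t)) from fun s t => by ring, key, mul_assoc,
      cyc_insert _ _ _ hpq hqr hpr hp.1 hq.1 hr.1]
    split_ifs <;> ring

/-- All words `u a y` with `u ∈ X` and `y ∈ Y`. -/
def joinAt (a : ℕ) (X Y : Multiset (List ℕ)) : Multiset (List ℕ) :=
  X.bind fun u => Y.map fun y => u ++ a :: y

/-- All words `B₁ a B₂ a ⋯ B_j a u` with `B_i ∈ B` and `u ∈ X`. -/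
def tails (a : ℕ) (B X : Multiset (List ℕ)) : ℕ → Multiset (List ℕ)
  | 0 => X
  | j + 1 => joinAt a B (tails a B X j)

/-- The words obtained by concatenating blocks `a B₁ a B₂ a ⋯ a` with `k a` copies of `a` and
`B_i ∈ B a`, where each letter of `A` is the outer letter of at most one block. -/
def words (k : ℕ → ℕ) (B : ℕ → Multiset (List ℕ)) : List ℕ → Multiset (List ℕ)
  | [] => {[]}
  | a :: A => words k B A + joinAt a (words k B A) (tails a (B a) (words k B A) (k a - 1))

/-- The words allowed between consecutive copies of `a` in a word with letters in `S`, with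
nesting depth bounded by the second argument. -/
def faces (k : ℕ → ℕ) (S : List ℕ) : ℕ → ℕ → Multiset (List ℕ)
  | 0, _ => 0
  | d + 1, a => words k (faces k S d) (S.erase a)

section Weights

variable {R : Type*} [CommSemiring R] (x y z : R) (U : ℕ → R)

/-- The weight of the path from `p` to `q` through the letters of a word. -/
def weight : ℕ → List ℕ → ℕ → R
  | p, [], q => step x y z p q
  | p, a :: w, q => step x y z p a * U a * weight a w q

/-- The total weight of a multiset of words. -/
def total (X : Multiset (List ℕ)) (p q : ℕ) : R := (X.map fun w => weight x y z U p w q).sum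

theorem weight_append (p q a : ℕ) (u w : List ℕ) :
    weight x y z U p (u ++ a :: w) q = weight x y z U p u a * U a * weight x y z U a w q := by
  induction u generalizing p with
  | nil => rfl
  | cons b u ih => simp only [List.cons_append, weight, ih, mul_assoc]

theorem total_joinAt (a p q : ℕ) (X Y : Multiset (List ℕ)) :
    total x y z U (joinAt a X Y) p q = total x y z U X p a * U a * total x y z U Y a q := by
  simp only [total, joinAt, Multiset.map_bind, Multiset.sum_bind, Multiset.map_map,
    Function.comp_def, weight_append, Multiset.sum_map_mul_left, Multiset.sum_map_mul_right]

theorem total_tails (a q j : ℕ) (B X : Multiset (List ℕ)) :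
    total x y z U (tails a B X j) a q
      = (total x y z U B a a * U a) ^ j * total x y z U X a q := by
  induction j with
  | zero => simp [tails]
  | succ j ih => rw [tails, total_joinAt, ih, pow_succ]; ring

variable {x y z U}

theorem exists_isTransfer_words {S : Subsemiring R} (hxy : x * y ∈ S) (hx : x + y ∈ S)
    (hU : ∀ a, U a ∈ S) (k : ℕ → ℕ) (B : ℕ → Multiset (List ℕ))
    (hB : ∀ a, total x y z U (B a) a a ∈ S) (A : List ℕ) (hA : A.Nodup) :
    ∃ Z ∈ S, IsTransfer x y z Z A (total x y z U (words k B A)) := by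
  induction A with
  | nil =>
    refine ⟨0, S.zero_mem, ?_⟩
    have : total x y z U (words k B []) = step x y z := by
      funext p q
      simp [total, words, weight]
    rw [this]
    exact isTransfer_nil x y z
  | cons a A ih =>
    rw [List.nodup_cons] at hA
    obtain ⟨Z, hZ, h⟩ := ih hA.2
    let v := U a * (total x y z U (B a) a a * U a) ^ (k a - 1)
    have hv : v ∈ S := S.mul_mem (hU a) (S.pow_mem (S.mul_mem (hB a) (hU a)) _)
    refine ⟨Z + v * ((x + Z) * (y + Z)), ?_, ?_⟩
    · have : (x + Z) * (y + Z) = x * y + (x + y) * Z + Z * Z := by ring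
      rw [this]
      exact S.add_mem hZ (S.mul_mem hv (S.add_mem (S.add_mem hxy (S.mul_mem hx hZ))
        (S.mul_mem hZ hZ)))
    · convert h.cons hA.1 v using 3 with p q
      rw [words]
      have : ∀ X Y : Multiset (List ℕ), total x y z U (X + Y) p q
          = total x y z U X p q + total x y z U Y p q := fun X Y => by simp [total]
      rw [this, total_joinAt, total_tails]
      ring

theorem total_faces_mem {S : Subsemiring R} (hxy : x * y ∈ S) (hx : x + y ∈ S) (hz : z ∈ S)
    (hU : ∀ a, U a ∈ S) (k : ℕ → ℕ) (T : List ℕ) (hT : T.Nodup) (d a : ℕ) :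
    total x y z U (faces k T d a) a a ∈ S := by
  induction d generalizing a with
  | zero => simp [faces, total]
  | succ d ih =>
    obtain ⟨Z, hZ, h⟩ := exists_isTransfer_words hxy hx hU k _ ih (T.erase a) (hT.erase a)
    rw [faces, h.diag a hT.not_mem_erase]
    exact S.add_mem hz hZ

theorem total_words_mem {S : Subsemiring R} (hxy : x * y ∈ S) (hx : x + y ∈ S) (hz : z ∈ S)
    (hU : ∀ a, U a ∈ S) (k : ℕ → ℕ) (T : List ℕ) (hT : T.Nodup) (d p : ℕ) (hp : p ∉ T) :
    total x y z U (words k (faces k T d) T) p p ∈ S := by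
  obtain ⟨Z, hZ, h⟩ := exists_isTransfer_words hxy hx hU k _
    (total_faces_mem hxy hx hz hU k T hT d) T hT
  rw [h.diag p hp]
  exact S.add_mem hz hZ

end Weights
/-- No two distinct letters cross. -/
def NonCrossing (w : List ℕ) : Prop := ∀ a b, a ≠ b → ¬ [a, b, a, b].Sublist w

theorem NonCrossing.sublist {w w' : List ℕ} (h : NonCrossing w) (hs : w'.Sublist w) :
    NonCrossing w' := fun a b hab hc => h a b hab (hc.trans hs)

/-- A pattern none of whose letters occurs in the middle factor survives deleting that factor. -/
theorem sublist_of_notMem_middle {l u B u' : List ℕ} (h : l.Sublist (u ++ B ++ u'))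
    (hl : ∀ c ∈ l, c ∉ B) : l.Sublist (u ++ u') := by
  have h' := h.filter (fun c => decide (c ∉ B))
  rw [List.filter_append, List.filter_append] at h'
  have h₁ : l.filter (fun c => decide (c ∉ B)) = l := by
    rw [List.filter_eq_self]; simpa using hl
  have h₂ : B.filter (fun c => decide (c ∉ B)) = [] := by
    rw [List.filter_eq_nil_iff]; simp
  rw [h₁, h₂, List.append_nil, ← List.filter_append] at h'
  exact h'.trans List.filter_sublist

/-- A pattern whose first and last letters occur only in the middle factor lies in it. -/
theorem sublist_middle {c : ℕ} {l u B u' : List ℕ} (h : (c :: (l ++ [c])).Sublist (u ++ B ++ u'))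
    (hu : c ∉ u) (hu' : c ∉ u') : (c :: (l ++ [c])).Sublist B := by
  induction u with
  | nil =>
    rw [List.nil_append] at h
    have h' := h.reverse
    rw [List.reverse_append] at h'
    have key : ∀ v : List ℕ, c ∉ v → (c :: (l.reverse ++ [c])).Sublist (v ++ B.reverse) →
        (c :: (l.reverse ++ [c])).Sublist B.reverse := by
      intro v hv hs
      induction v with
      | nil => simpa using hs
      | cons d v ih =>
        rw [List.mem_cons, not_or] at hv
        rw [List.cons_append, List.sublist_cons_iff] at hs
        rcases hs with hs | ⟨r, hr, -⟩
        · exact ih hv.2 hs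
        · exact absurd (List.cons.inj hr).1 hv.1
    have h'' := key u'.reverse (by simpa using hu') (by simpa using h')
    simpa using h''.reverse
  | cons d u ih =>
    rw [List.mem_cons, not_or] at hu
    rw [List.cons_append, List.cons_append, List.sublist_cons_iff] at h
    rcases h with h | ⟨r, hr, -⟩
    · exact ih h hu.2
    · exact absurd (List.cons.inj hr).1 hu.1

theorem NonCrossing.insert {u B u' : List ℕ} (h : NonCrossing (u ++ u')) (hB : NonCrossing B)
    (hd : ∀ b ∈ B, b ∉ u ∧ b ∉ u') : NonCrossing (u ++ B ++ u') := by
  intro c b hcb hs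
  have hmem : ∀ e f : ℕ, e ∈ B → [e, f, e].Sublist (u ++ B ++ u') → f ∈ B := fun e f he hs' =>
    (sublist_middle (l := [f]) hs' (hd e he).1 (hd e he).2).subset (by simp)
  have hc : c ∈ B → b ∈ B := fun hc => hmem c b hc (List.Sublist.trans (by simp) hs)
  have hb : b ∈ B → c ∈ B := fun hb => hmem b c hb (List.Sublist.trans (by simp) hs)
  by_cases hcB : c ∈ B
  · have hbB := hc hcB
    have h₁ := hs.filter (fun e => decide (e ∈ B))
    rw [List.filter_append, List.filter_append] at h₁
    have h₂ : u.filter (fun e => decide (e ∈ B)) = [] := by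
      rw [List.filter_eq_nil_iff]; intro e he; simpa using fun heB => (hd e heB).1 he
    have h₃ : u'.filter (fun e => decide (e ∈ B)) = [] := by
      rw [List.filter_eq_nil_iff]; intro e he; simpa using fun heB => (hd e heB).2 he
    rw [h₂, h₃, List.append_nil, List.nil_append] at h₁
    simp only [List.filter_cons, hcB, hbB, decide_true, if_true, List.filter_nil] at h₁
    exact hB c b hcb (h₁.trans List.filter_sublist)
  · refine h c b hcb (sublist_of_notMem_middle hs ?_)
    intro e he
    simp only [List.mem_cons, List.not_mem_nil, or_false] at he
    rcases he with rfl | rfl | rfl | rfl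
    exacts [hcB, fun hb' => hcB (hb hb'), hcB, fun hb' => hcB (hb hb')]

theorem NonCrossing.dup {a : ℕ} {w : List ℕ} (h : NonCrossing (a :: w)) :
    NonCrossing (a :: a :: w) := by
  intro c b hcb hs
  rw [List.sublist_cons_iff] at hs
  rcases hs with hs | ⟨r, hr, hs⟩
  · exact h c b hcb hs
  · obtain ⟨rfl, rfl⟩ := List.cons.inj hr
    rw [List.sublist_cons_iff] at hs
    rcases hs with hs | ⟨r, hr, -⟩
    · exact h _ _ hcb (hs.cons_cons c)
    · exact hcb (List.cons.inj hr).1.symm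

/-- Every letter outside `A` is enclosed by two copies of some other letter. -/
def TopIn (A w : List ℕ) : Prop := ∀ c ∈ w, c ∉ A → ∃ b, b ≠ c ∧ [b, c, b].Sublist w

theorem mem_joinAt {a : ℕ} {X Y : Multiset (List ℕ)} {w : List ℕ} :
    w ∈ joinAt a X Y ↔ ∃ u ∈ X, ∃ y ∈ Y, u ++ a :: y = w := by
  simp [joinAt, Multiset.mem_bind]

section Support

variable {k : ℕ → ℕ} {B : ℕ → Multiset (List ℕ)}

theorem le_count_tails {X : Multiset (List ℕ)} {a : ℕ}
    (hB : ∀ w ∈ B a, ∀ b ∈ w, k b ≤ w.count b)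
    (hX : ∀ w ∈ X, ∀ b ∈ w, k b ≤ w.count b) (j : ℕ) :
    ∀ w ∈ tails a (B a) X j, j ≤ w.count a ∧ ∀ b ∈ w, b ≠ a → k b ≤ w.count b := by
  induction j with
  | zero => exact fun w hw => ⟨Nat.zero_le _, fun b hb _ => hX w hw b hb⟩
  | succ j ih =>
    intro w hw
    obtain ⟨u, hu, y, hy, rfl⟩ := mem_joinAt.1 hw
    obtain ⟨h₁, h₂⟩ := ih y hy
    refine ⟨?_, fun b hb hba => ?_⟩
    · rw [List.count_append, List.count_cons_self]; omega
    · rw [List.count_append, List.count_cons_of_ne (Ne.symm hba)]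
      rw [List.mem_append, List.mem_cons] at hb
      rcases hb with hb | hb | hb
      · have := hB u hu b hb; omega
      · exact absurd hb hba
      · have := h₂ b hb hba; omega

theorem le_count_words (hB : ∀ a, ∀ w ∈ B a, ∀ b ∈ w, k b ≤ w.count b) (A : List ℕ) :
    ∀ w ∈ words k B A, ∀ b ∈ w, k b ≤ w.count b := by
  induction A with
  | nil => intro w hw; simp only [words, Multiset.mem_singleton] at hw; simp [hw]
  | cons a A ih =>
    intro w hw b hb
    rw [words, Multiset.mem_add] at hw
    rcases hw with hw | hw
    · exact ih w hw b hb
    · obtain ⟨u, hu, y, hy, rfl⟩ := mem_joinAt.1 hw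
      obtain ⟨h₁, h₂⟩ := le_count_tails (hB a) ih _ y hy
      by_cases hba : b = a
      · subst hba
        rw [List.count_append, List.count_cons_self]; omega
      · rw [List.count_append, List.count_cons_of_ne (Ne.symm hba)]
        rw [List.mem_append, List.mem_cons] at hb
        rcases hb with hb | hb | hb
        · have := ih u hu b hb; omega
        · exact absurd hb hba
        · have := h₂ b hb hba; omega

end Support

theorem le_count_faces (k : ℕ → ℕ) (S : List ℕ) (d a : ℕ) :
    ∀ w ∈ faces k S d a, ∀ b ∈ w, k b ≤ w.count b := by
  induction d generalizing a with
  | zero => simp [faces]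
  | succ d ih => exact le_count_words ih _

/-- In a word `u ++ a :: y` in which no letter is used too often, a letter `u` uses fully does
not occur in `y`. -/
theorem notMem_right {k : ℕ → ℕ} {u v : List ℕ} {b : ℕ} (h : (u ++ v).count b ≤ k b)
    (hk : k b ≤ u.count b) : b ∉ v := by
  rw [List.count_append] at h
  rw [← List.count_eq_zero]
  omega

section Sound

variable {k : ℕ → ℕ} {B : ℕ → Multiset (List ℕ)}

/-- The properties shared by the tails following the first copy of `a`. -/
theorem tails_sound {A : List ℕ} {X : Multiset (List ℕ)} {a : ℕ}
    (hB : ∀ w ∈ B a, ∀ b ∈ w, k b ≤ w.count b)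
    (hBs : ∀ w ∈ B a, (∀ b, w.count b ≤ k b) → NonCrossing w)
    (hXs : ∀ w ∈ X, (∀ b, w.count b ≤ k b) → NonCrossing w ∧ TopIn A w)
    (hX : ∀ w ∈ X, ∀ b ∈ w, k b ≤ w.count b) (j : ℕ) :
    ∀ y ∈ tails a (B a) X j, y.count a = j → (∀ b, y.count b ≤ k b) →
      NonCrossing (a :: y) ∧
        ∀ c ∈ y, c ≠ a → c ∉ A → ∃ b, b ≠ c ∧ [b, c, b].Sublist (a :: y) := by
  induction j with
  | zero =>
    intro y hy hc hk
    obtain ⟨h₁, h₂⟩ := hXs y hy hk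
    rw [List.count_eq_zero] at hc
    refine ⟨?_, fun c hcy _ hcA => ?_⟩
    · have := NonCrossing.insert (u := [a]) (B := y) (u' := []) ?_ h₁ ?_
      · simpa using this
      · intro c b hcb hs
        simpa using hs.length_le
      · intro b hb
        refine ⟨?_, by simp⟩
        rw [List.mem_singleton]
        rintro rfl
        exact hc hb
    · obtain ⟨b, hb, hs⟩ := h₂ c hcy hcA
      exact ⟨b, hb, hs.cons a⟩
  | succ j ih =>
    intro w hw hc hk
    obtain ⟨u, hu, y, hy, rfl⟩ := mem_joinAt.1 hw
    have h₁ := (le_count_tails hB hX j y hy).1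
    have hcu : u.count a = 0 ∧ y.count a = j := by
      rw [List.count_append, List.count_cons_self] at hc; omega
    have hku : ∀ b, u.count b ≤ k b := fun b =>
      (List.Sublist.count_le b (List.sublist_append_left u (a :: y))).trans (hk b)
    have hky : ∀ b, y.count b ≤ k b := fun b =>
      (List.Sublist.count_le b ((List.sublist_cons_self a y).trans
        (List.sublist_append_right u (a :: y)))).trans (hk b)
    obtain ⟨h₂, h₃⟩ := ih y hy hcu.2 hky
    refine ⟨?_, fun c hcy hca hcA => ?_⟩
    · refine NonCrossing.insert (u := [a]) (B := u) (u' := a :: y) h₂.dup (hBs u hu hku) ?_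
      intro b hb
      refine ⟨?_, notMem_right (hk b) (hB u hu b hb)⟩
      rw [List.mem_singleton]
      rintro rfl
      exact (List.count_eq_zero.1 hcu.1) hb
    · rw [List.mem_append, List.mem_cons] at hcy
      rcases hcy with hcy | hcy | hcy
      · refine ⟨a, Ne.symm hca, List.Sublist.cons_cons a ?_⟩
        exact List.Sublist.append (List.singleton_sublist.2 hcy)
          (List.singleton_sublist.2 (List.mem_cons_self (l := y)))
      · exact absurd hcy hca
      · obtain ⟨b, hb, hs⟩ := h₃ c hcy hca hcA
        exact ⟨b, hb, (hs.trans (List.sublist_append_right u _)).cons a⟩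

theorem joinAt_sound {A : List ℕ} {X : Multiset (List ℕ)} {a : ℕ}
    (hB : ∀ w ∈ B a, ∀ b ∈ w, k b ≤ w.count b)
    (hBs : ∀ w ∈ B a, (∀ b, w.count b ≤ k b) → NonCrossing w)
    (hXs : ∀ w ∈ X, (∀ b, w.count b ≤ k b) → NonCrossing w ∧ TopIn A w)
    (hX : ∀ w ∈ X, ∀ b ∈ w, k b ≤ w.count b) {w : List ℕ}
    (hw : w ∈ joinAt a X (tails a (B a) X (k a - 1))) (hk : ∀ b, w.count b ≤ k b) :
    NonCrossing w ∧ TopIn (a :: A) w ∧ a ∈ w ∧ ∀ b, b ≠ a → ¬ [b, a, b].Sublist w := by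
  obtain ⟨u, hu, y, hy, rfl⟩ := mem_joinAt.1 hw
  have h₁ := (le_count_tails hB hX _ y hy).1
  have hcu : u.count a = 0 ∧ y.count a = k a - 1 := by
    have := hk a
    rw [List.count_append, List.count_cons_self] at this; omega
  have hku : ∀ b, u.count b ≤ k b := fun b =>
    (List.Sublist.count_le b (List.sublist_append_left u (a :: y))).trans (hk b)
  have hky : ∀ b, y.count b ≤ k b := fun b =>
    (List.Sublist.count_le b ((List.sublist_cons_self a y).trans
      (List.sublist_append_right u (a :: y)))).trans (hk b)
  obtain ⟨h₂, h₃⟩ := tails_sound hB hBs hXs hX _ y hy hcu.2 hky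
  obtain ⟨h₄, h₅⟩ := hXs u hu hku
  have hdisj : ∀ b ∈ u, b ∉ a :: y := fun b hb => notMem_right (hk b) (hX u hu b hb)
  refine ⟨?_, fun c hc hcA => ?_, by simp, fun b hba hs => ?_⟩
  · have := NonCrossing.insert (u := []) (B := u) (u' := a :: y) (by simpa using h₂) h₄
      (fun b hb => ⟨by simp, hdisj b hb⟩)
    simpa using this
  · rw [List.mem_cons, not_or] at hcA
    rw [List.mem_append, List.mem_cons] at hc
    rcases hc with hc | hc | hc
    · obtain ⟨b, hb, hs⟩ := h₅ c hc hcA.2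
      exact ⟨b, hb, hs.trans (List.sublist_append_left u _)⟩
    · exact absurd hc hcA.1
    · obtain ⟨b, hb, hs⟩ := h₃ c hc hcA.1 hcA.2
      exact ⟨b, hb, hs.trans (List.sublist_append_right u _)⟩
  · by_cases hbu : b ∈ u
    · have := sublist_middle (c := b) (l := [a]) (u := []) (B := u) (u' := a :: y)
        (by simpa using hs) (by simp) (hdisj b hbu)
      exact List.count_eq_zero.1 hcu.1 (this.subset (by simp))
    · have := sublist_of_notMem_middle (u := []) (B := u) (u' := a :: y) (l := [b, a, b])
        (by simpa using hs) (by simpa [hbu] using List.count_eq_zero.1 hcu.1)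
      rw [List.nil_append, List.sublist_cons_iff] at this
      rcases this with this | ⟨r, hr, -⟩
      · exact h₂ a b (Ne.symm hba) (this.cons_cons a)
      · exact hba (List.cons.inj hr).1

theorem words_sound (hB : ∀ a, ∀ w ∈ B a, ∀ b ∈ w, k b ≤ w.count b)
    (hBs : ∀ a, ∀ w ∈ B a, (∀ b, w.count b ≤ k b) → NonCrossing w) (A : List ℕ) :
    ∀ w ∈ words k B A, (∀ b, w.count b ≤ k b) → NonCrossing w ∧ TopIn A w := by
  induction A with
  | nil =>
    intro w hw _
    simp only [words, Multiset.mem_singleton] at hw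
    subst hw
    exact ⟨fun a b _ hs => by simp at hs, fun c hc => by simp at hc⟩
  | cons a A ih =>
    intro w hw hk
    rw [words, Multiset.mem_add] at hw
    rcases hw with hw | hw
    · obtain ⟨h₁, h₂⟩ := ih w hw hk
      exact ⟨h₁, fun c hc hcA => h₂ c hc fun h => hcA (List.mem_cons_of_mem _ h)⟩
    · obtain ⟨h₁, h₂, -⟩ := joinAt_sound (hB a) (hBs a) ih (le_count_words hB A) hw hk
      exact ⟨h₁, h₂⟩

end Sound

theorem faces_sound (k : ℕ → ℕ) (S : List ℕ) (d a : ℕ) :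
    ∀ w ∈ faces k S d a, (∀ b, w.count b ≤ k b) → NonCrossing w := by
  induction d generalizing a with
  | zero => simp [faces]
  | succ d ih => exact fun w hw hk => (words_sound (le_count_faces k S d) ih _ w hw hk).1

theorem append_cons_inj {a : ℕ} {u u' y y' : List ℕ} (hu : a ∉ u) (hu' : a ∉ u')
    (h : u ++ a :: y = u' ++ a :: y') : u = u' ∧ y = y' := by
  induction u generalizing u' with
  | nil => cases u' <;> simp_all
  | cons b u ih =>
    cases u' with
    | nil =>
      rw [List.cons_append, List.nil_append, List.cons.injEq] at h
      exact absurd (by simp [h.1]) hu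
    | cons c u' =>
      rw [List.mem_cons, not_or] at hu hu'
      rw [List.cons_append, List.cons_append, List.cons.injEq] at h
      obtain ⟨rfl, rfl⟩ := ih hu.2 hu'.2 h.2
      exact ⟨by rw [h.1], rfl⟩

theorem count_joinAt_le_one {a : ℕ} {X Y : Multiset (List ℕ)} {w : List ℕ}
    (h : ∀ u ∈ X, ∀ y ∈ Y, u ++ a :: y = w → a ∉ u ∧ X.count u ≤ 1 ∧ Y.count y ≤ 1) :
    (joinAt a X Y).count w ≤ 1 := by
  by_cases hw : w ∈ joinAt a X Y
  · obtain ⟨u, hu, y, hy, hs⟩ := mem_joinAt.1 hw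
    obtain ⟨hau, hX, hY⟩ := h u hu y hy hs
    have hcongr : X.map (fun v => (Y.map fun t => v ++ a :: t).count w)
        = X.map (fun v => if v = u then Y.count y else 0) := by
      refine Multiset.map_congr rfl fun v hv => ?_
      split_ifs with hvu
      · subst hvu
        rw [← hs]
        exact Multiset.count_map_eq_count' (fun t => v ++ a :: t) _
          (fun s t hst => by simpa using hst) y
      · rw [Multiset.count_eq_zero, Multiset.mem_map]
        rintro ⟨t, ht, hvt⟩
        exact hvu (append_cons_inj (h v hv t ht hvt).1 hau (hvt.trans hs.symm)).1
    have hsum : ∀ (Z : Multiset (List ℕ)) (n : ℕ),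
        (Z.map fun v => if v = u then n else 0).sum = Z.count u * n := by
      intro Z n
      induction Z using Multiset.induction_on with
      | empty => simp
      | cons v Z ih =>
        rw [Multiset.map_cons, Multiset.sum_cons, ih, Multiset.count_cons]
        by_cases hvu : v = u
        · simp [hvu]; ring
        · simp [hvu, Ne.symm hvu]
    rw [joinAt, Multiset.count_bind, hcongr, hsum]
    exact Nat.mul_le_mul hX hY
  · rw [Multiset.count_eq_zero_of_notMem hw]
    exact Nat.zero_le 1

theorem count_left_le {k : ℕ → ℕ} {u v : List ℕ} (h : ∀ b, (u ++ v).count b ≤ k b) (b : ℕ) :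
    u.count b ≤ k b := (List.Sublist.count_le b (List.sublist_append_left u v)).trans (h b)

theorem count_right_le {k : ℕ → ℕ} {a : ℕ} {u v : List ℕ} (h : ∀ b, (u ++ a :: v).count b ≤ k b)
    (b : ℕ) : v.count b ≤ k b :=
  (List.Sublist.count_le b ((List.sublist_cons_self a v).trans
    (List.sublist_append_right u (a :: v)))).trans (h b)

section Nodup

variable {k : ℕ → ℕ} {B : ℕ → Multiset (List ℕ)}

theorem count_tails_le_one {X : Multiset (List ℕ)} {a : ℕ}
    (hB : ∀ w ∈ B a, ∀ b ∈ w, k b ≤ w.count b)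
    (hX : ∀ w ∈ X, ∀ b ∈ w, k b ≤ w.count b)
    (hBn : ∀ w, (∀ b, w.count b ≤ k b) → (B a).count w ≤ 1)
    (hXn : ∀ w, (∀ b, w.count b ≤ k b) → X.count w ≤ 1) (j : ℕ) :
    ∀ y : List ℕ, y.count a = j → (∀ b, y.count b ≤ k b) →
      (tails a (B a) X j).count y ≤ 1 := by
  induction j with
  | zero => exact fun y _ hk => hXn y hk
  | succ j ih =>
    intro w hc hk
    refine count_joinAt_le_one ?_
    rintro u hu y hy rfl
    have h₁ := (le_count_tails hB hX j y hy).1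
    rw [List.count_append, List.count_cons_self] at hc
    exact ⟨List.count_eq_zero.1 (by omega), hBn u (count_left_le hk),
      ih y (by omega) (count_right_le hk)⟩

theorem count_words_le_one (hB : ∀ a, ∀ w ∈ B a, ∀ b ∈ w, k b ≤ w.count b)
    (hBs : ∀ a, ∀ w ∈ B a, (∀ b, w.count b ≤ k b) → NonCrossing w)
    (hBn : ∀ a w, (∀ b, w.count b ≤ k b) → (B a).count w ≤ 1) (A : List ℕ) (hA : A.Nodup) :
    ∀ w : List ℕ, (∀ b, w.count b ≤ k b) → (words k B A).count w ≤ 1 := by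
  induction A with
  | nil => intro w _; exact Multiset.nodup_iff_count_le_one.1 (Multiset.nodup_singleton _) w
  | cons a A ih =>
    intro w hk
    rw [List.nodup_cons] at hA
    have hX := le_count_words hB A
    rw [words, Multiset.count_add]
    have h₁ := ih hA.2 w hk
    have h₂ : (joinAt a (words k B A) (tails a (B a) (words k B A) (k a - 1))).count w ≤ 1 := by
      refine count_joinAt_le_one ?_
      rintro u hu y hy rfl
      have hc := hk a
      have h₁ := (le_count_tails (hB a) hX _ y hy).1
      rw [List.count_append, List.count_cons_self] at hc
      exact ⟨List.count_eq_zero.1 (by omega), ih hA.2 u (count_left_le hk),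
        count_tails_le_one (hB a) hX (hBn a) (ih hA.2) _ y (by omega) (count_right_le hk)⟩
    by_cases hw : w ∈ joinAt a (words k B A) (tails a (B a) (words k B A) (k a - 1))
    · obtain ⟨-, -, haw, hs⟩ := joinAt_sound (hB a) (hBs a) (words_sound hB hBs A) hX hw hk
      have : w ∉ words k B A := fun hw' => by
        obtain ⟨b, hb, hs'⟩ := (words_sound hB hBs A w hw' hk).2 a haw hA.1
        exact hs b hb hs'
      rw [Multiset.count_eq_zero_of_notMem this]
      omega
    · rw [Multiset.count_eq_zero_of_notMem hw]
      omega

end Nodup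

theorem count_faces_le_one (k : ℕ → ℕ) (S : List ℕ) (hS : S.Nodup) (d a : ℕ) :
    ∀ w : List ℕ, (∀ b, w.count b ≤ k b) → (faces k S d a).count w ≤ 1 := by
  induction d generalizing a with
  | zero => simp [faces]
  | succ d ih =>
    exact count_words_le_one (le_count_faces k S d) (faces_sound k S d) ih _ (hS.erase a)

section Complete

variable {k : ℕ → ℕ} {B : ℕ → Multiset (List ℕ)} {S : List ℕ} {d : ℕ}

theorem mem_tails {A : List ℕ} {X : Multiset (List ℕ)} {a : ℕ}
    (hB : ∀ w : List ℕ, w.length < d → w ⊆ S → a ∉ w → (∀ b ∈ w, w.count b = k b) →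
      NonCrossing w → w ∈ B a)
    (hX : ∀ w : List ℕ, w.length ≤ d → w ⊆ S → (∀ b ∈ w, w.count b = k b) →
      NonCrossing w → TopIn A w → w ∈ X) (j : ℕ) :
    ∀ y : List ℕ, y.length ≤ d → y ⊆ S → y.count a = j → (∀ b ∈ y, b ≠ a → y.count b = k b) →
      NonCrossing (a :: y) →
      (∀ c ∈ y, c ≠ a → c ∉ A → ∃ b, b ≠ c ∧ [b, c, b].Sublist (a :: y)) →
      y ∈ tails a (B a) X j := by
  induction j with
  | zero =>
    intro y hl hS hc hk hN hT
    rw [List.count_eq_zero] at hc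
    have hne : ∀ b ∈ y, b ≠ a := fun b hb hba => hc (hba ▸ hb)
    refine hX y hl hS (fun b hb => hk b hb (hne b hb)) (hN.sublist (List.sublist_cons_self a y))
      fun c hcy hcA => ?_
    obtain ⟨b, hbc, hs⟩ := hT c hcy (hne c hcy) hcA
    refine ⟨b, hbc, ?_⟩
    rw [List.sublist_cons_iff] at hs
    rcases hs with hs | ⟨r, hr, hs⟩
    · exact hs
    · obtain ⟨rfl, rfl⟩ := List.cons.inj hr
      exact absurd (hs.subset (by simp)) hc
  | succ j ih =>
    intro w hl hS hc hk hN hT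
    obtain ⟨u, y, rfl, hau⟩ := List.eq_append_cons_of_mem
      (List.count_pos_iff.1 (by omega : 0 < w.count a))
    rw [List.count_append, List.count_cons_self, List.count_eq_zero.2 hau] at hc
    have hdisj : ∀ b ∈ u, b ∉ a :: y := by
      intro b hb hby
      rw [List.mem_cons] at hby
      rcases hby with rfl | hby
      · exact hau hb
      · refine hN a b (fun h => hau (h ▸ hb)) (List.Sublist.cons_cons a ?_)
        exact List.Sublist.append (List.singleton_sublist.2 hb)
          (List.Sublist.cons_cons a (List.singleton_sublist.2 hby))
    rw [List.length_append, List.length_cons] at hl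
    refine mem_joinAt.2 ⟨u, hB u (by omega) (fun b hb => hS (by simp [hb])) hau ?_ ?_, y,
      ih y (by omega) (fun b hb => hS (by simp [hb])) (by omega) ?_ ?_ ?_, rfl⟩
    · intro b hb
      rw [← hk b (by simp [hb]) (fun h => hau (h ▸ hb)), List.count_append,
        List.count_eq_zero.2 (hdisj b hb), add_zero]
    · exact hN.sublist ((List.sublist_append_left u _).cons a)
    · intro b hb hba
      rw [← hk b (by simp [hb]) hba, List.count_append, List.count_cons_of_ne (Ne.symm hba),
        List.count_eq_zero.2 (fun hbu => hdisj b hbu (List.mem_cons_of_mem a hb)), zero_add]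
    · exact hN.sublist ((List.sublist_append_right u _).cons a)
    · intro c hcy hca hcA
      obtain ⟨b, hbc, hs⟩ := hT c (by simp [hcy]) hca hcA
      refine ⟨b, hbc, ?_⟩
      have hcu : c ∉ u := fun h => hdisj c h (List.mem_cons_of_mem a hcy)
      have hs' : [b, c, b].Sublist ([a] ++ u ++ a :: y) := hs
      have hbu : b ∉ u := by
        intro hbu
        have := sublist_middle (l := [c]) hs'
          (by rw [List.mem_singleton]; rintro rfl; exact hau hbu) (hdisj b hbu)
        exact hcu (this.subset (by simp))
      have h₁ : [b, c, b].Sublist (a :: a :: y) :=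
        sublist_of_notMem_middle hs' (by simp [hbu, hcu])
      rw [List.sublist_cons_iff] at h₁
      rcases h₁ with h₁ | ⟨r, hr, h₁⟩
      · exact h₁
      · obtain ⟨rfl, rfl⟩ := List.cons.inj hr
        rw [List.sublist_cons_iff] at h₁
        rcases h₁ with h₁ | ⟨r, hr, -⟩
        · exact h₁.cons_cons b
        · exact absurd (List.cons.inj hr).1 hca

theorem mem_words (hB : ∀ a, ∀ w : List ℕ, w.length < d → w ⊆ S → a ∉ w →
      (∀ b ∈ w, w.count b = k b) → NonCrossing w → w ∈ B a) (A : List ℕ) :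
    ∀ w : List ℕ, w.length ≤ d → w ⊆ S → (∀ b ∈ w, w.count b = k b) →
      NonCrossing w → TopIn A w → w ∈ words k B A := by
  induction A with
  | nil =>
    intro w _ _ _ hN hT
    cases w with
    | nil => simp [words]
    | cons a w =>
      obtain ⟨b, hba, hs⟩ := hT a (by simp) (by simp)
      rw [List.sublist_cons_iff] at hs
      rcases hs with hs | ⟨r, hr, -⟩
      · exact absurd (hs.cons_cons a) (hN a b (Ne.symm hba))
      · exact absurd (List.cons.inj hr).1 hba
  | cons a A ih =>
    intro w hl hS hk hN hT
    rw [words, Multiset.mem_add]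
    by_cases ha : a ∈ w ∧ ∀ b, b ≠ a → ¬ [b, a, b].Sublist w
    · right
      obtain ⟨haw, htop⟩ := ha
      obtain ⟨u, y, rfl, hau⟩ := List.eq_append_cons_of_mem haw
      have hdisj : ∀ b ∈ u, b ∉ a :: y := by
        intro b hb hby
        rw [List.mem_cons] at hby
        rcases hby with rfl | hby
        · exact hau hb
        · exact htop b (fun h => hau (h ▸ hb)) (List.Sublist.append (List.singleton_sublist.2 hb)
            (List.Sublist.cons_cons a (List.singleton_sublist.2 hby)))
      have hka := hk a haw
      rw [List.count_append, List.count_cons_self, List.count_eq_zero.2 hau] at hka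
      rw [List.length_append, List.length_cons] at hl
      refine mem_joinAt.2 ⟨u, ih u (by omega) (fun b hb => hS (by simp [hb])) ?_ ?_ ?_, y,
        mem_tails (hB a) ih _ y (by omega) (fun b hb => hS (by simp [hb])) (by omega) ?_ ?_ ?_,
        rfl⟩
      · intro b hb
        rw [← hk b (by simp [hb]), List.count_append, List.count_eq_zero.2 (hdisj b hb), add_zero]
      · exact hN.sublist (List.sublist_append_left u _)
      · intro c hcu hcA
        obtain ⟨b, hbc, hs⟩ := hT c (by simp [hcu]) (by
          rw [List.mem_cons, not_or]; exact ⟨fun h => hau (h ▸ hcu), hcA⟩)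
        refine ⟨b, hbc, ?_⟩
        by_cases hbu : b ∈ u
        · exact sublist_middle (l := [c]) (u := []) (u' := a :: y) hs (by simp) (hdisj b hbu)
        · have := sublist_middle (l := [c]) (u := u) (B := a :: y) (u' := []) (by simpa using hs)
            hbu (by simp)
          exact absurd (this.subset (by simp)) (hdisj c hcu)
      · intro b hb hba
        rw [← hk b (by simp [hb]), List.count_append, List.count_cons_of_ne (Ne.symm hba),
          List.count_eq_zero.2 (fun hbu => hdisj b hbu (List.mem_cons_of_mem a hb)), zero_add]
      · exact hN.sublist (List.sublist_append_right u _)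
      · intro c hcy hca hcA
        obtain ⟨b, hbc, hs⟩ := hT c (by simp [hcy]) (by
          rw [List.mem_cons, not_or]; exact ⟨hca, hcA⟩)
        refine ⟨b, hbc, ?_⟩
        by_cases hbu : b ∈ u
        · have := sublist_middle (l := [c]) (u := []) (u' := a :: y) hs (by simp) (hdisj b hbu)
          exact absurd (List.mem_cons_of_mem a hcy) (hdisj c (this.subset (by simp)))
        · exact sublist_middle (l := [c]) (u := u) (B := a :: y) (u' := []) (by simpa using hs)
            hbu (by simp)
    · left
      refine ih w hl hS hk hN fun c hc hcA => ?_
      by_cases hca : c = a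
      · subst hca
        push Not at ha
        exact ha hc
      · exact hT c hc (by rw [List.mem_cons, not_or]; exact ⟨hca, hcA⟩)

end Complete

theorem mem_faces (k : ℕ → ℕ) (S : List ℕ) (d a : ℕ) (w : List ℕ) (hl : w.length < d)
    (hS : w ⊆ S) (ha : a ∉ w) (hk : ∀ b ∈ w, w.count b = k b) (hN : NonCrossing w) :
    w ∈ faces k S d a := by
  induction d generalizing a w with
  | zero => omega
  | succ d ih =>
    refine mem_words (S := S) (d := d) (fun a w hl hS ha hk hN => ih a w hl hS ha hk hN) _ w
      (by omega) hS hk hN fun c hc hcS => ?_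
    exact absurd ((List.mem_erase_of_ne fun h : c = a => ha (h ▸ hc)).2 (hS hc)) hcS

/-- A word with full multiplicities occurs among the block words iff it is noncrossing, and then
it occurs exactly once. -/
theorem count_words_faces {k : ℕ → ℕ} {S : List ℕ} (hSn : S.Nodup) {d : ℕ} {w : List ℕ}
    (hl : w.length ≤ d) (hS : w ⊆ S) (hk : ∀ b ∈ w, w.count b = k b) [Decidable (NonCrossing w)] :
    (words k (faces k S d) S).count w = if NonCrossing w then 1 else 0 := by
  have hk' : ∀ b, w.count b ≤ k b := fun b => by
    by_cases hb : b ∈ w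
    · exact (hk b hb).le
    · rw [List.count_eq_zero.2 hb]; exact Nat.zero_le _
  split_ifs with hN
  · refine le_antisymm (count_words_le_one (le_count_faces k S d) (faces_sound k S d)
      (count_faces_le_one k S hSn d) S hSn w hk') (Multiset.one_le_count_iff_mem.2 ?_)
    exact mem_words (S := S) (mem_faces k S d) S w hl hS hk hN fun c hc hcS => absurd (hS hc) hcS
  · rw [Multiset.count_eq_zero]
    exact fun hw => hN (words_sound (le_count_faces k S d) (faces_sound k S d) S w hw hk').1

open MvPolynomial

/-- The consecutive pairs of letters of the word `p w q`. -/
def transitions (p : ℕ) (w : List ℕ) (q : ℕ) : List (ℕ × ℕ) := (p :: (w ++ [q])).zip (w ++ [q])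

theorem transitions_nil (p q : ℕ) : transitions p [] q = [(p, q)] := rfl

theorem transitions_cons (p a : ℕ) (w : List ℕ) (q : ℕ) :
    transitions p (a :: w) q = (p, a) :: transitions a w q := rfl

/-- The number of ascents of the word `p w q`. -/
def ascents (p : ℕ) (w : List ℕ) (q : ℕ) : ℕ := (transitions p w q).countP fun t => t.1 < t.2

/-- The number of descents of the word `p w q`. -/
def descents (p : ℕ) (w : List ℕ) (q : ℕ) : ℕ := (transitions p w q).countP fun t => t.2 < t.1

/-- The number of plateaus of the word `p w q`. -/
def plateaus (p : ℕ) (w : List ℕ) (q : ℕ) : ℕ := (transitions p w q).countP fun t => t.1 = t.2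

theorem ascW_eq (w : List ℕ) : ascW w = ascents 0 w 0 := rfl

theorem desW_eq (w : List ℕ) : desW w = descents 0 w 0 := rfl

theorem platW_eq (w : List ℕ) : platW w = plateaus 0 w 0 := rfl

theorem ascents_add_descents_add_plateaus (p q : ℕ) (w : List ℕ) :
    ascents p w q + descents p w q + plateaus p w q = w.length + 1 := by
  induction w generalizing p with
  | nil =>
    rcases lt_trichotomy p q with h | rfl | h <;>
      simp [ascents, descents, plateaus, transitions_nil, *, ne_of_lt, ne_of_gt, not_lt_of_gt]
  | cons a w ih =>
    have := ih a
    simp only [ascents, descents, plateaus, transitions_cons, List.countP_cons, decide_eq_true_eq,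
      List.length_cons] at this ⊢
    split_ifs <;> omega

theorem one_le_descents {p : ℕ} (hp : 0 < p) (w : List ℕ) : 1 ≤ descents p w 0 := by
  induction w generalizing p with
  | nil => simp [descents, transitions_nil, hp]
  | cons a w ih =>
    rcases Nat.eq_zero_or_pos a with rfl | h
    · simp [descents, transitions_cons, hp]
    · have := ih h
      simp only [descents, transitions_cons, List.countP_cons] at this ⊢
      omega

theorem plateaus_add_card_le {p : ℕ} (hp : 0 < p) {w : List ℕ} (hw : ∀ a ∈ w, 0 < a) :
    plateaus p w 0 + (p :: w).toFinset.card ≤ (p :: w).length := by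
  induction w generalizing p with
  | nil => simp [plateaus, transitions_nil, hp.ne']
  | cons a w ih =>
    have := ih (hw a (by simp)) fun b hb => hw b (by simp [hb])
    rw [List.toFinset_cons, List.length_cons]
    simp only [plateaus, transitions_cons, List.countP_cons] at this ⊢
    by_cases h : p = a
    · subst h
      rw [Finset.insert_eq_of_mem (by simp)]
      simp only [decide_true, if_true]
      omega
    · have := Finset.card_insert_le p (a :: w).toFinset
      simp only [h, decide_false, Bool.false_eq_true, if_false]
      omega

/-- The generating monomial `x ^ asc * y ^ des * z ^ plat` of the word `p w q`. -/
noncomputable def statMonomial (p : ℕ) (w : List ℕ) (q : ℕ) : MvPolynomial (Fin 3) ℕ :=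
  X 0 ^ ascents p w q * X 1 ^ descents p w q * X 2 ^ plateaus p w q

theorem statMonomial_nil (p q : ℕ) : statMonomial p [] q = step (X 0) (X 1) (X 2) p q := by
  rcases lt_trichotomy p q with h | rfl | h
  · simp [statMonomial, step, ascents, descents, plateaus, transitions_nil, h, h.not_gt, h.ne]
  · simp [statMonomial, step, ascents, descents, plateaus, transitions_nil]
  · simp [statMonomial, step, ascents, descents, plateaus, transitions_nil, h, h.not_gt, h.ne']

theorem statMonomial_cons (p a q : ℕ) (w : List ℕ) :
    statMonomial p (a :: w) q = step (X 0) (X 1) (X 2) p a * statMonomial a w q := by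
  rcases lt_trichotomy p a with h | rfl | h
  · simp [statMonomial, step, ascents, descents, plateaus, transitions_cons, h, h.not_gt, h.ne,
      pow_succ]
    ring
  · simp [statMonomial, step, ascents, descents, plateaus, transitions_cons, pow_succ]
    ring
  · simp [statMonomial, step, ascents, descents, plateaus, transitions_cons, h, h.not_gt, h.ne',
      pow_succ]
    ring

theorem step_map {R R' : Type*} (f : R → R') (x y z : R) (p q : ℕ) :
    step (f x) (f y) (f z) p q = f (step x y z p q) := by
  unfold step; split_ifs <;> rfl

theorem weight_eq_monomial (p q : ℕ) (w : List ℕ) :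
    weight (C (X 0)) (C (X 1)) (C (X 2))
      (X : ℕ → MvPolynomial ℕ (MvPolynomial (Fin 3) ℕ)) p w q =
    monomial (Multiset.toFinsupp (w : Multiset ℕ)) (statMonomial p w q) := by
  induction w generalizing p with
  | nil =>
    rw [weight, statMonomial_nil, step_map (C : _ → MvPolynomial ℕ (MvPolynomial (Fin 3) ℕ))]
    rfl
  | cons a w ih =>
    rw [weight, ih, statMonomial_cons, step_map (C : _ → MvPolynomial ℕ (MvPolynomial (Fin 3) ℕ)),
      ← Multiset.cons_coe, ← Multiset.singleton_add, map_add, Multiset.toFinsupp_singleton,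
      X.eq_def a, C_mul_monomial, monomial_mul, mul_one]

theorem coeff_total (Y : Multiset (List ℕ)) (M : Multiset ℕ) (p q : ℕ) (F : Finset (List ℕ))
    (hF : ∀ w : List ℕ, (w : Multiset ℕ) = M → Y.count w = if w ∈ F then 1 else 0)
    (hM : ∀ w ∈ F, (w : Multiset ℕ) = M) :
    coeff (Multiset.toFinsupp M) (total (C (X 0)) (C (X 1)) (C (X 2))
      (X : ℕ → MvPolynomial ℕ (MvPolynomial (Fin 3) ℕ)) Y p q) = ∑ w ∈ F, statMonomial p w q := by
  have h : F ⊆ Y.toFinset := fun w hw => by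
    rw [Multiset.mem_toFinset, ← Multiset.one_le_count_iff_mem, hF w (hM w hw), if_pos hw]
  rw [total, Finset.sum_multiset_map_count, coeff_sum, ← Finset.sum_subset h]
  · refine Finset.sum_congr rfl fun w hw => ?_
    rw [hF w (hM w hw), if_pos hw, one_smul, weight_eq_monomial, coeff_monomial, if_pos (by rw [hM w hw])]
  · intro w _ hw
    rw [weight_eq_monomial, coeff_smul, coeff_monomial]
    split_ifs with h
    · rw [hF w (Multiset.toFinsupp.injective h), if_neg hw, zero_smul]
    · rw [smul_zero]

theorem isQuasiStirling_iff (w : List ℕ) :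
    IsQuasiStirling w ↔ ∀ a b, ¬ [a, b, a, b].Sublist w := by
  constructor
  · rintro h a b hab
    obtain ⟨f, hf⟩ := List.sublist_iff_exists_fin_orderEmbedding_get_eq.1 hab
    have h0 := hf (0 : Fin 4)
    have h1 := hf (1 : Fin 4)
    have h2 := hf (2 : Fin 4)
    have h3 := hf (3 : Fin 4)
    have m01 : f (0 : Fin 4) < f (1 : Fin 4) := f.lt_iff_lt.2 (by simp)
    have m12 : f (1 : Fin 4) < f (2 : Fin 4) := f.lt_iff_lt.2 (by simp [Fin.lt_def])
    have m23 : f (2 : Fin 4) < f (3 : Fin 4) := f.lt_iff_lt.2 (by simp)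
    refine h ⟨f (3 : Fin 4), (f (3 : Fin 4)).2, f (2 : Fin 4), m23, f (1 : Fin 4), m12,
      f (0 : Fin 4), m01, ?_, ?_⟩ <;>
    simp_all
  · rintro h ⟨l, hl, k, hk, j, hj, i, hi, h1, h2⟩
    have := List.map_getElem_sublist (l := w)
      (is := [⟨i, by omega⟩, ⟨j, by omega⟩, ⟨k, by omega⟩, ⟨l, hl⟩])
      (by simp; omega)
    simp only [List.map_cons, List.map_nil, Fin.getElem_fin] at this
    rw [List.getD_eq_getElem _ _ (by omega), List.getD_eq_getElem _ _ (by omega)] at h1 h2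
    rw [← h1, ← h2] at this
    exact h _ _ this

theorem isQuasiStirling_iff_nonCrossing {w : List ℕ} (hw : ∀ a, w.count a ≤ 3) :
    IsQuasiStirling w ↔ NonCrossing w := by
  rw [isQuasiStirling_iff]
  refine ⟨fun h a b _ => h a b, fun h a b hs => ?_⟩
  by_cases hab : a = b
  · subst hab
    have := hs.count_le a
    simp at this
    have := hw a
    omega
  · exact h a b hab hs

theorem count_lt_four_of_isQuasiStirling {w : List ℕ} (hw : IsQuasiStirling w) (a : ℕ) :
    w.count a ≤ 3 := by
  by_contra! h
  exact (isQuasiStirling_iff w).1 hw a a (List.replicate_sublist_iff.2 h)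

theorem mem_qsPerms {M : Multiset ℕ} {w : List ℕ} :
    w ∈ qsPerms M ↔ (w : Multiset ℕ) = M ∧ IsQuasiStirling w := by
  rw [qsPerms, permsOf, Finset.mem_filter, List.mem_toFinset, List.mem_permutations,
    ← Multiset.coe_eq_coe, Multiset.coe_toList]

theorem count_msetM (n : ℕ) (k : ℕ → ℕ) (b : ℕ) :
    (msetM n k).count b = if b ∈ Finset.Icc 1 n then k b else 0 := by
  rw [msetM, Multiset.count_sum']
  simp [Multiset.count_replicate]

theorem card_msetM (n : ℕ) (k : ℕ → ℕ) :
    Multiset.card (msetM n k) = ∑ i ∈ Finset.Icc 1 n, k i := by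
  simp [msetM]

/-- The exponent vector of `x ^ a * y ^ b * z ^ c`. -/
noncomputable def expVec (a b c : ℕ) : Fin 3 →₀ ℕ :=
  Finsupp.single 0 a + Finsupp.single 1 b + Finsupp.single 2 c

theorem expVec_apply_zero (a b c : ℕ) : expVec a b c 0 = a := by simp [expVec]

theorem expVec_apply_one (a b c : ℕ) : expVec a b c 1 = b := by simp [expVec]

theorem expVec_apply_two (a b c : ℕ) : expVec a b c 2 = c := by simp [expVec]

theorem expVec_self (s : Fin 3 →₀ ℕ) : expVec (s 0) (s 1) (s 2) = s := by
  ext i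
  fin_cases i
  · exact expVec_apply_zero ..
  · exact expVec_apply_one ..
  · exact expVec_apply_two ..

theorem monomial_expVec (a b c : ℕ) :
    (X 0 ^ a * X 1 ^ b * X 2 ^ c : MvPolynomial (Fin 3) ℕ) = monomial (expVec a b c) 1 := by
  simp [expVec, X_pow_eq_monomial, monomial_mul]

/-- The substitution `x ↦ x + y`, `y ↦ x * y`, `z ↦ z`. -/
noncomputable def gammaHom : MvPolynomial (Fin 3) ℕ →ₐ[ℕ] MvPolynomial (Fin 3) ℕ :=
  aeval ![X 0 + X 1, X 0 * X 1, X 2]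

theorem gammaHom_eq_sum (f : MvPolynomial (Fin 3) ℕ) :
    gammaHom f = ∑ s ∈ f.support,
      C (coeff s f) * ((X 0 + X 1) ^ s 0 * (X 0 * X 1) ^ s 1 * X 2 ^ s 2) := by
  rw [gammaHom, aeval_eq_eval₂Hom, coe_eval₂Hom, eval₂_eq']
  simp [Fin.prod_univ_three]

theorem exists_add_pow_eq {R : Type*} [CommSemiring R] (x y : R) (n : ℕ) :
    ∃ g, (x + y) ^ n = x ^ n + g := by
  induction n with
  | zero => exact ⟨0, by simp⟩
  | succ n ih =>
    obtain ⟨g, hg⟩ := ih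
    exact ⟨x ^ n * y + g * (x + y), by rw [pow_succ, hg]; ring⟩

theorem coeff_gammaHom_ne_zero {f : MvPolynomial (Fin 3) ℕ} {s : Fin 3 →₀ ℕ} (hs : s ∈ f.support) :
    coeff (expVec (s 0 + s 1) (s 1) (s 2)) (gammaHom f) ≠ 0 := by
  rw [gammaHom_eq_sum, coeff_sum]
  refine (lt_of_lt_of_le ?_ (Finset.single_le_sum (fun _ _ => Nat.zero_le _) hs)).ne'
  obtain ⟨g, hg⟩ := exists_add_pow_eq (X 0 : MvPolynomial (Fin 3) ℕ) (X 1) (s 0)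
  have h : ((X 0 + X 1) ^ s 0 * (X 0 * X 1) ^ s 1 * X 2 ^ s 2 : MvPolynomial (Fin 3) ℕ) =
      X 0 ^ (s 0 + s 1) * X 1 ^ s 1 * X 2 ^ s 2 + g * (X 0 * X 1) ^ s 1 * X 2 ^ s 2 := by
    rw [hg]; ring
  rw [h, monomial_expVec, coeff_C_mul, coeff_add, coeff_monomial, if_pos rfl]
  exact Nat.mul_pos (Nat.pos_of_ne_zero (mem_support_iff.1 hs)) (by omega)

/-- Expansion of an element of the range of `gammaHom` along its possible exponents. -/
theorem map_gammaHom_eq_sum {f : MvPolynomial (Fin 3) ℕ} {N m : ℕ}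
    (hf : ∀ s ∈ f.support, s 0 + 2 * s 1 + s 2 = N ∧ 1 ≤ s 1 ∧ s 2 ≤ m) :
    map (Nat.castRingHom ℤ) (gammaHom f) =
      ∑ i ∈ Finset.range (m + 1), (X 2 : MvPolynomial (Fin 3) ℤ) ^ i *
        ∑ j ∈ Finset.Icc 1 ((N - i) / 2),
          ((coeff (expVec (N - i - 2 * j) j i) f : ℕ) : MvPolynomial (Fin 3) ℤ) *
            (X 0 * X 1) ^ j * (X 0 + X 1) ^ (N - i - 2 * j) := by
  set F : (Fin 3 →₀ ℕ) → MvPolynomial (Fin 3) ℤ := fun s =>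
    ((coeff s f : ℕ) : MvPolynomial (Fin 3) ℤ) *
      ((X 0 + X 1) ^ s 0 * (X 0 * X 1) ^ s 1 * X 2 ^ s 2) with hF
  set T := (Finset.range (m + 1)).sigma fun i => Finset.Icc 1 ((N - i) / 2)
  have hl : map (Nat.castRingHom ℤ) (gammaHom f) = ∑ s ∈ f.support, F s := by
    simp [gammaHom_eq_sum, hF]
  have hr : ∀ t ∈ T, F (expVec (N - t.1 - 2 * t.2) t.2 t.1) = X 2 ^ t.1 *
      (((coeff (expVec (N - t.1 - 2 * t.2) t.2 t.1) f : ℕ) : MvPolynomial (Fin 3) ℤ) *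
            (X 0 * X 1) ^ t.2 * (X 0 + X 1) ^ (N - t.1 - 2 * t.2)) := by
    intro t _
    simp only [hF, expVec_apply_zero, expVec_apply_one, expVec_apply_two]
    ring
  simp_rw [Finset.mul_sum]
  rw [Finset.sum_sigma', ← Finset.sum_congr rfl hr, hl,
    ← Finset.sum_image (g := fun t : (_ : ℕ) × ℕ => expVec (N - t.1 - 2 * t.2) t.2 t.1)]
  · refine Finset.sum_subset (fun s hs => ?_) fun s _ hs => ?_
    · obtain ⟨h1, h2, h3⟩ := hf s hs
      refine Finset.mem_image.2 ⟨⟨s 2, s 1⟩, ?_, ?_⟩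
      · simp only [T, Finset.mem_sigma, Finset.mem_range, Finset.mem_Icc]
        omega
      · have : N - s 2 - 2 * s 1 = s 0 := by omega
        simp only [this, expVec_self]
    · simp [hF, notMem_support_iff.1 hs]
  · rintro ⟨i, j⟩ _ ⟨i', j'⟩ _ h
    have h1 := DFunLike.congr_fun h 1
    have h2 := DFunLike.congr_fun h 2
    simp only [expVec_apply_one, expVec_apply_two] at h1 h2
    rw [h1, h2]

theorem exists_gammaHom_eq {n : ℕ} {k : ℕ → ℕ} (hk : ∀ a ∈ Finset.Icc 1 n, k a ≤ 3) :
    ∃ f, gammaHom f = ∑ w ∈ qsPerms (msetM n k), statMonomial 0 w 0 := by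
  set S : Subsemiring (MvPolynomial (Fin 3) ℕ) := gammaHom.toRingHom.rangeS
  have hS : ∀ g, gammaHom g ∈ S := fun g => ⟨g, rfl⟩
  set S' : Subsemiring (MvPolynomial ℕ (MvPolynomial (Fin 3) ℕ)) := (map S.subtype).rangeS
  have hC : ∀ r ∈ S, C r ∈ S' := fun r hr => ⟨C ⟨r, hr⟩, by simp⟩
  have h := total_words_mem (x := C (X 0)) (y := C (X 1)) (z := C (X 2)) (U := X) (S := S')
    (by rw [← C_mul]; exact hC _ (by simpa [gammaHom] using hS (X 1)))
    (by rw [← C_add]; exact hC _ (by simpa [gammaHom] using hS (X 0)))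
    (hC _ (by simpa [gammaHom] using hS (X 2)))
    (fun a => ⟨X a, by simp⟩) k (List.range' 1 n) List.nodup_range'
    (Multiset.card (msetM n k)) 0 (by simp)
  obtain ⟨g, hg⟩ := h
  have h3 := coeff_total (words k (faces k (List.range' 1 n) (Multiset.card (msetM n k)))
    (List.range' 1 n)) (msetM n k) 0 0 (qsPerms (msetM n k)) (fun w hw => ?_)
    fun w hw => (mem_qsPerms.1 hw).1
  · rw [← h3, ← hg, coeff_map]
    exact (coeff (Multiset.toFinsupp (msetM n k)) g).2
  · have hc : ∀ b, w.count b = if b ∈ Finset.Icc 1 n then k b else 0 := fun b => by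
      rw [← count_msetM, ← hw, Multiset.coe_count]
    have hm : ∀ b ∈ w, b ∈ Finset.Icc 1 n := fun b hb => by
      by_contra h
      have := List.count_pos_iff.2 hb
      rw [hc, if_neg h] at this
      omega
    have h3 : ∀ b, w.count b ≤ 3 := fun b => by
      rw [hc]
      split_ifs with hb
      exacts [hk b hb, by omega]
    rw [count_words_faces List.nodup_range' (by rw [← hw]; rfl)
      (fun b hb => by have := hm b hb; simp at this ⊢; omega)
      (fun b hb => by rw [hc, if_pos (hm b hb)])]
    simp only [mem_qsPerms, hw, true_and, isQuasiStirling_iff_nonCrossing h3]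

theorem stat_bounds {n : ℕ} (hn : 1 ≤ n) {k : ℕ → ℕ} (hk : ∀ i, 1 ≤ i → i ≤ n → 1 ≤ k i)
    {w : List ℕ} (hw : (w : Multiset ℕ) = msetM n k) :
    1 ≤ descents 0 w 0 ∧ plateaus 0 w 0 + n ≤ w.length := by
  have hm : ∀ b, b ∈ w ↔ 1 ≤ b ∧ b ≤ n := fun b => by
    have := hk b
    rw [← List.count_pos_iff, ← Multiset.coe_count, hw, count_msetM]
    split_ifs with h <;> rw [Finset.mem_Icc] at h <;> omega
  have hcard : w.toFinset.card = n := by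
    have : w.toFinset = Finset.Icc 1 n := by ext b; simp [hm]
    simp [this]
  cases w with
  | nil => simp at hcard; omega
  | cons a w =>
    have ha : 0 < a := ((hm a).1 (by simp)).1
    have h1 := one_le_descents ha w
    have h2 := plateaus_add_card_le (w := w) ha fun b hb => ((hm b).1 (by simp [hb])).1
    rw [hcard] at h2
    refine ⟨?_, ?_⟩
    · simp only [descents, transitions_cons, List.countP_cons] at h1 ⊢
      omega
    · simp only [plateaus, transitions_cons, List.countP_cons] at h2 ⊢
      rw [if_neg (by simpa using ha.ne)]
      exact h2

end QuasiStirling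

open MvPolynomial in
/-- **Conjecture of Lin–Ma–Zhang, proved by Yan–Huang–Yang.**  For
`M = {1^{k 1}, …, n^{k n}}` with every `k i ≥ 1` and `K = k 1 + ⋯ + k n`, the polynomial
`Q̄_M(x,y,z) = ∑_{π quasi-Stirling perm. of M} x^{asc π} y^{des π} z^{plat π}` is partial
γ-positive: there are nonnegative integers `γ i j` with
`Q̄_M(x,y,z) = ∑_{i=0}^{K-n} z^i ∑_{j=1}^{⌊(K+1-i)/2⌋} γ i j (xy)^j (x+y)^{K+1-i-2j}`.
Here `x = X 0`, `y = X 1`, `z = X 2` in `ℤ[x,y,z] = MvPolynomial (Fin 3) ℤ`. -/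
theorem quasiStirling_poly_partial_gamma_positive
    (n : ℕ) (hn : 1 ≤ n) (k : ℕ → ℕ) (hk : ∀ i, 1 ≤ i → i ≤ n → 1 ≤ k i)
    (K : ℕ) (hK : K = ∑ i ∈ Finset.Icc 1 n, k i) :
    ∃ γ : ℕ → ℕ → ℕ,
      QbarPoly (msetM n k)
        = ∑ i ∈ Finset.range (K - n + 1), (X 2 : MvPolynomial (Fin 3) ℤ) ^ i *
            ∑ j ∈ Finset.Icc 1 ((K + 1 - i) / 2),
              (γ i j : MvPolynomial (Fin 3) ℤ)
                * (X 0 * X 1) ^ j * (X 0 + X 1) ^ (K + 1 - i - 2 * j) := by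
  by_cases h3 : ∀ a ∈ Finset.Icc 1 n, k a ≤ 3
  · obtain ⟨f, hf⟩ := QuasiStirling.exists_gammaHom_eq h3
    have hQ : QbarPoly (msetM n k) = map (Nat.castRingHom ℤ) (QuasiStirling.gammaHom f) := by
      simp [hf, QbarPoly, QuasiStirling.statMonomial, QuasiStirling.ascW_eq,
        QuasiStirling.desW_eq, QuasiStirling.platW_eq]
    refine ⟨fun i j => coeff (QuasiStirling.expVec (K + 1 - i - 2 * j) j i) f, ?_⟩
    rw [hQ]
    refine QuasiStirling.map_gammaHom_eq_sum fun s hs => ?_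
    have hne := QuasiStirling.coeff_gammaHom_ne_zero hs
    rw [hf, coeff_sum] at hne
    obtain ⟨w, hw, hne⟩ := Finset.exists_ne_zero_of_sum_ne_zero hne
    have hwM := (QuasiStirling.mem_qsPerms.1 hw).1
    rw [QuasiStirling.statMonomial, QuasiStirling.monomial_expVec, coeff_monomial] at hne
    have he := of_not_not fun h => hne (if_neg h)
    have h0 := DFunLike.congr_fun he 0
    have h1 := DFunLike.congr_fun he 1
    have h2 := DFunLike.congr_fun he 2
    simp only [QuasiStirling.expVec_apply_zero, QuasiStirling.expVec_apply_one,
      QuasiStirling.expVec_apply_two] at h0 h1 h2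
    have hl : w.length = K := by
      rw [hK, ← QuasiStirling.card_msetM, ← hwM, Multiset.coe_card]
    have hsum := QuasiStirling.ascents_add_descents_add_plateaus 0 0 w
    have hb := QuasiStirling.stat_bounds hn hk hwM
    omega
  · push Not at h3
    obtain ⟨a, ha, h3⟩ := h3
    have he : qsPerms (msetM n k) = ∅ := Finset.eq_empty_of_forall_notMem fun w hw => by
      obtain ⟨hw, hq⟩ := QuasiStirling.mem_qsPerms.1 hw
      have := QuasiStirling.count_lt_four_of_isQuasiStirling hq a
      rw [← Multiset.coe_count, hw, QuasiStirling.count_msetM, if_pos ha] at this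
      omega
    exact ⟨0, by simp [QbarPoly, he]⟩
end
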